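/- arXiv:1812.11812 — 12 statements merged into one kernel-verified Lean document; each statement's English description precedes it below -/
import Mathlib

section
/- Let q be a prime power, n, m, s, t positive integers with s·t = q^m − 1, let F be a finite field with q^n elements, and let a ∈ F, a ≠ 0. Then the map c ↦ c·(c^s − a)^t is a bijection of F if and only if there is no b ∈ F with b ≠ 0 and b^s = a. -/
/-- In a finite field whose cardinality is a power of the prime power `q`, raising to the power
`q ^ m` is compatible with subtraction. -/
theorem sub_pow_pow_of_card_eq {q n : ℕ} (hq : IsPrimePow q) {F : Type*} [Field F] [Fintype F]
    (hF : Fintype.card F = q ^ n) (m : ℕ) (x y : F) :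
    (x - y) ^ q ^ m = x ^ q ^ m - y ^ q ^ m := by
  obtain ⟨p, k, hp, -, rfl⟩ := hq
  have hp' : p.Prime := hp.nat_prime
  have : Fact p.Prime := ⟨hp'⟩
  have : CharP F p := by
    obtain ⟨r, hr⟩ := CharP.exists F
    obtain ⟨l, hr', hl⟩ := FiniteField.card F r
    have hrp : r = p := by
      rw [hF, ← pow_mul] at hl
      exact (Nat.prime_dvd_prime_iff_eq hr' hp').1
        (hr'.dvd_of_dvd_pow (hl ▸ dvd_pow_self r l.ne_zero))
    exact hrp ▸ hr
  rw [← pow_mul, sub_pow_char_pow]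

/-- If `x (x ^ s - a) ^ t` takes the same nonzero value at two points whose `s`-th powers differ,
then `a` is an `s`-th power. -/
theorem pow_eq_of_mul_sub_pow_eq {F : Type*} [Field F] {s t Q : ℕ} (hst : s * t + 1 = Q)
    (hQ : ∀ x y : F, (x - y) ^ Q = x ^ Q - y ^ Q) {a x y : F}
    (hx : x ^ s - a ≠ 0) (hy : y ^ s - a ≠ 0) (hxy : x ^ s ≠ y ^ s)
    (h : x * (x ^ s - a) ^ t = y * (y ^ s - a) ^ t) :
    (x * (x ^ s - a) ^ t * ((x ^ s - a)⁻¹ - (y ^ s - a)⁻¹) ^ t) ^ s = a := by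
  set e := x * (x ^ s - a) ^ t with he
  have key : ∀ w : F, w ^ s - a ≠ 0 → e = w * (w ^ s - a) ^ t →
      e ^ s * (w ^ s - a)⁻¹ ^ Q = a * (w ^ s - a)⁻¹ + 1 := by
    intro w hw hew
    rw [hew, mul_pow, ← pow_mul, mul_comm t s, ← hst, pow_succ, inv_pow]
    field_simp
    ring
  have hz : (x ^ s - a)⁻¹ - (y ^ s - a)⁻¹ ≠ 0 :=
    fun h0 => hxy (sub_left_injective (inv_injective (sub_eq_zero.1 h0)))
  apply mul_right_cancel₀ hz
  rw [mul_pow, ← pow_mul, mul_comm t s, mul_assoc, ← pow_succ, hst, hQ, mul_sub,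
    key x hx he, key y hy h]
  ring

/-- `x(x^s - a)^t` with `st = q^m - 1` permutes `F = 𝔽_{q^n}` iff `a` is not an
`s`-th power of a nonzero element. -/
theorem stmt_0 (q n m s t : ℕ) (hq : IsPrimePow q) (hn : 0 < n) (hm : 0 < m)
    (hs : 0 < s) (ht : 0 < t) (hst : s * t = q ^ m - 1)
    (F : Type*) [Field F] [Fintype F] (hF : Fintype.card F = q ^ n)
    (a : F) (ha : a ≠ 0) :
    Function.Bijective (fun c : F => c * (c ^ s - a) ^ t) ↔
      ¬ ∃ b : F, b ≠ 0 ∧ b ^ s = a := by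
  constructor
  · rintro ⟨hinj, -⟩ ⟨b, hb, hba⟩
    exact hb (hinj (by simp [hba, ht.ne']))
  · intro hroot
    have hsub : ∀ c : F, c ^ s - a ≠ 0 := by
      intro c hc
      have hca := sub_eq_zero.1 hc
      refine hroot ⟨c, ?_, hca⟩
      rintro rfl
      exact ha (by rw [← hca, zero_pow hs.ne'])
    refine Finite.injective_iff_bijective.1 fun x y h => ?_
    by_cases hxy : x ^ s = y ^ s
    · simp only [hxy] at h
      exact mul_right_cancel₀ (pow_ne_zero t (hsub y)) h
    · have hst' : s * t + 1 = q ^ m := by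
        rw [hst, Nat.sub_add_cancel (Nat.one_le_pow _ _ hq.pos)]
      exact absurd (sub_eq_zero.2 (pow_eq_of_mul_sub_pow_eq hst' (sub_pow_pow_of_card_eq hq hF m)
        (hsub x) (hsub y) hxy h)) (hsub _)
end

section
/- Let q be a prime power, n, m, s, t positive integers with s·t = q^m − 1, let F be a finite field with q^n elements, and let a ∈ F, a ≠ 0. Set s̄ = gcd(s, q^n − 1). Then the map c ↦ c·(c^s − a)^t is a bijection of F if and only if a^{(q^n − 1)/s̄} ≠ 1. -/
/-- In a finite cyclic group, `a` is an `s`-th power as soon as it is killed by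
`|G| / gcd(s, |G|)`. -/
theorem IsCyclic.exists_pow_eq_of_pow_card_div_gcd {G : Type*} [CommGroup G] [Finite G]
    [IsCyclic G] (s : ℕ) (a : G) (h : a ^ (Nat.card G / Nat.gcd s (Nat.card G)) = 1) :
    ∃ b : G, b ^ s = a := by
  obtain ⟨g, hg⟩ := IsCyclic.exists_zpow_surjective (G := G)
  obtain ⟨i, rfl⟩ := hg a
  have hord : orderOf g = Nat.card G := orderOf_eq_card_of_forall_mem_zpowers fun x => hg x
  have hN : 0 < Nat.card G := Nat.card_pos
  set N := Nat.card G
  set d := Nat.gcd s N with hd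
  have hdpos : 0 < d := Nat.gcd_pos_of_pos_right _ hN
  obtain ⟨e, he⟩ : d ∣ N := Nat.gcd_dvd_right s N
  have hepos : 0 < e := Nat.pos_of_mul_pos_left (he ▸ hN)
  rw [he, Nat.mul_div_cancel_left _ hdpos] at h
  have hdvd : (N : ℤ) ∣ i * e := by
    rw [← hord, orderOf_dvd_iff_zpow_eq_one, zpow_mul, zpow_natCast]
    exact h
  obtain ⟨j, rfl⟩ : (d : ℤ) ∣ i := by
    rw [he, Nat.cast_mul] at hdvd
    exact Int.dvd_of_mul_dvd_mul_right (by exact_mod_cast hepos.ne') hdvd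
  refine ⟨g ^ (Nat.gcdA s N * j), ?_⟩
  have hgN : g ^ (N : ℤ) = 1 := by rw [← hord, zpow_natCast, pow_orderOf_eq_one]
  beta_reduce
  rw [hd, Nat.gcd_eq_gcd_ab, add_mul, zpow_add, mul_assoc (N : ℤ), zpow_mul g N, hgN, one_zpow,
    mul_one, ← zpow_natCast, ← zpow_mul]
  congr 1
  ring

/-- If `u (u - a) ^ (Q - 1)` takes the same value at two points, where `x ↦ x ^ Q` is additive,
then either the points agree or `a` is that value times a `(Q - 1)`-st power. -/
theorem exists_mul_pow_eq_of_mul_sub_pow_eq {F : Type*} [Field F] {r : ℕ}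
    (hadd : ∀ x y : F, (x - y) ^ (r + 1) = x ^ (r + 1) - y ^ (r + 1)) {a u v w : F}
    (hua : u - a ≠ 0) (hva : v - a ≠ 0) (huv : u ≠ v)
    (hu : u * (u - a) ^ r = w) (hv : v * (v - a) ^ r = w) :
    ∃ z : F, w * z ^ r = a := by
  have key : ∀ x : F, x - a ≠ 0 → x * (x - a) ^ r = w →
      w * ((x - a)⁻¹) ^ (r + 1) = a * (x - a)⁻¹ + 1 := by
    intro x hx hxw
    rw [← hxw, inv_pow, pow_succ]
    field_simp
    ring
  have hz : (u - a)⁻¹ - (v - a)⁻¹ ≠ 0 := fun h =>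
    huv (sub_left_injective (inv_injective (sub_eq_zero.mp h)))
  refine ⟨(u - a)⁻¹ - (v - a)⁻¹, mul_right_cancel₀ hz ?_⟩
  rw [mul_assoc, ← pow_succ, hadd, mul_sub, key u hua hu, key v hva hv]
  ring

/-- `x(x^s - a)^t` with `st = q^m - 1` permutes `F = 𝔽_{q^n}` iff
`a^{(q^n-1)/s̄} ≠ 1` where `s̄ = gcd(s, q^n - 1)`. -/
theorem stmt_1 (q n m s t : ℕ) (hq : IsPrimePow q) (hn : 0 < n) (hm : 0 < m)
    (hs : 0 < s) (ht : 0 < t) (hst : s * t = q ^ m - 1)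
    (F : Type*) [Field F] [Fintype F] (hF : Fintype.card F = q ^ n)
    (a : F) (ha : a ≠ 0) :
    Function.Bijective (fun c : F => c * (c ^ s - a) ^ t) ↔
      a ^ ((q ^ n - 1) / Nat.gcd s (q ^ n - 1)) ≠ 1 := by
  have hcard : Nat.card Fˣ = q ^ n - 1 := by
    classical
    rw [Nat.card_eq_fintype_card, Fintype.card_units, hF]
  constructor
  · intro hbij h
    obtain ⟨b, hb⟩ := IsCyclic.exists_pow_eq_of_pow_card_div_gcd s (Units.mk0 a ha) (by
      rw [hcard]; ext; simpa using h)
    have hb' : (b : F) ^ s = a := by simpa using congrArg Units.val hb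
    refine b.ne_zero (hbij.injective (a₂ := 0) ?_)
    simp [hb', ht.ne']
  · intro h
    have hpow : ∀ b : F, b ^ s ≠ a := by
      rintro b rfl
      have hb : b ≠ 0 := by rintro rfl; simp [hs.ne'] at ha
      apply h
      rw [← pow_mul, ← Nat.mul_div_assoc _ (Nat.gcd_dvd_right _ _), mul_comm,
        Nat.mul_div_assoc _ (Nat.gcd_dvd_left _ _), pow_mul, ← hF,
        FiniteField.pow_card_sub_one_eq_one b hb, one_pow]
    obtain ⟨p, k, hp, hk, rfl⟩ := hq
    have hp' : p.Prime := hp.nat_prime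
    have : Fact p.Prime := ⟨hp'⟩
    have : CharP F p := charP_of_card_eq_prime_pow (f := k * n) (by rw [hF, pow_mul])
    have hr : s * t + 1 = p ^ (k * m) := by
      rw [hst, pow_mul]
      exact Nat.sub_add_cancel (Nat.one_le_pow _ _ (pow_pos hp'.pos _))
    refine Finite.injective_iff_bijective.mp fun c d hcd => ?_
    have hcd' : c * (c ^ s - a) ^ t = d * (d ^ s - a) ^ t := hcd
    have hne : ∀ b : F, b ^ s - a ≠ 0 := fun b => sub_ne_zero.mpr (hpow b)
    have hw : ∀ b : F, b ^ s * (b ^ s - a) ^ (s * t) = (b * (b ^ s - a) ^ t) ^ s := fun b => by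
      rw [mul_pow, ← pow_mul, mul_comm t s]
    have hsd : c ^ s = d ^ s := by
      by_contra huv
      obtain ⟨z, hz⟩ := exists_mul_pow_eq_of_mul_sub_pow_eq (r := s * t)
        (fun x y => by rw [hr, sub_pow_char_pow]) (hne c) (hne d) huv (hw c)
        ((hw d).trans (by rw [hcd']))
      refine hpow (c * (c ^ s - a) ^ t * z ^ t) ?_
      rw [mul_pow, ← pow_mul, mul_comm t s, hz]
    rw [hsd] at hcd'
    exact mul_right_cancel₀ (pow_ne_zero _ (hne d)) hcd'
end

section
/- Let q be a prime power, n ≥ 2, and 1 ≤ m ≤ n − 1. Let F be a finite field with q^n elements, a ∈ F with a ≠ 0, and set d = gcd(m, n). Then the map c ↦ c^{q^m} − a·c is a bijection of F if and only if a^{(q^n − 1)/(q^d − 1)} ≠ 1. -/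
/-- In a finite cyclic group of order `N`, the `k`-th powers are the elements whose order divides
`N / gcd N k`. -/
theorem exists_pow_eq_iff_pow_card_div_gcd_eq_one {G : Type*} [CommGroup G] [Finite G]
    [IsCyclic G] (x : G) (k : ℕ) :
    (∃ y : G, y ^ k = x) ↔ x ^ (Nat.card G / Nat.gcd (Nat.card G) k) = 1 := by
  have hN : 0 < Nat.card G := Nat.card_pos
  have hg : 0 < Nat.gcd (Nat.card G) k := Nat.gcd_pos_of_pos_left _ hN
  obtain ⟨u, hu⟩ := Nat.gcd_dvd_left (Nat.card G) k
  obtain ⟨v, hv⟩ := Nat.gcd_dvd_right (Nat.card G) k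
  have hdiv : Nat.card G / Nat.gcd (Nat.card G) k = u := Nat.div_eq_of_eq_mul_right hg hu
  rw [hdiv]
  constructor
  · rintro ⟨y, rfl⟩
    have h : k * u = Nat.card G * v := by
      calc k * u = Nat.gcd (Nat.card G) k * v * u := by rw [← hv]
        _ = Nat.gcd (Nat.card G) k * u * v := by ring
        _ = Nat.card G * v := by rw [← hu]
    rw [← pow_mul, h, pow_mul, pow_card_eq_one', one_pow]
  · intro hx
    obtain ⟨γ, hgen⟩ := IsCyclic.exists_monoid_generator (α := G)
    have hγ : orderOf γ = Nat.card G := orderOf_eq_card_of_forall_mem_powers hgen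
    obtain ⟨t, rfl⟩ := hgen x
    dsimp only at hx ⊢
    rw [← pow_mul, ← orderOf_dvd_iff_pow_eq_one, hγ] at hx
    have hu0 : 0 < u := by
      rcases Nat.eq_zero_or_pos u with h | h
      · rw [h, mul_zero] at hu
        omega
      · exact h
    obtain ⟨w, rfl⟩ : Nat.gcd (Nat.card G) k ∣ t := by
      apply Nat.dvd_of_mul_dvd_mul_right hu0
      rwa [← hu]
    refine ⟨γ ^ (Nat.gcdB (Nat.card G) k * w), ?_⟩
    rw [← zpow_natCast, ← zpow_natCast, ← zpow_mul, Nat.cast_mul, Nat.gcd_eq_gcd_ab,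
      add_mul, zpow_add, mul_assoc (Nat.card G : ℤ), zpow_mul γ (Nat.card G : ℤ), zpow_natCast,
      pow_card_eq_one', one_zpow, one_mul]
    congr 1
    ring

/-- `L(x) = x^{q^m} - a x` permutes `F = 𝔽_{q^n}` iff
`a^{(q^n-1)/(q^d-1)} ≠ 1` where `d = gcd(m, n)`. -/
theorem stmt_2 (q n m : ℕ) (hq : IsPrimePow q) (hn : 2 ≤ n) (hm1 : 1 ≤ m)
    (hm2 : m ≤ n - 1)
    (F : Type*) [Field F] [Fintype F] (hF : Fintype.card F = q ^ n)
    (a : F) (ha : a ≠ 0) :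
    Function.Bijective (fun c : F => c ^ (q ^ m) - a * c) ↔
      a ^ ((q ^ n - 1) / (q ^ Nat.gcd m n - 1)) ≠ 1 := by
  have hqm : q ^ m ≠ 0 := pow_ne_zero _ hq.ne_zero
  have hcard : Nat.card Fˣ = q ^ n - 1 := by
    rw [Nat.card_units, Nat.card_eq_fintype_card, hF]
  have key := exists_pow_eq_iff_pow_card_div_gcd_eq_one (Units.mk0 a ha) (q ^ m - 1)
  rw [hcard, Nat.pow_sub_one_gcd_pow_sub_one, Nat.gcd_comm n m, Units.ext_iff,
    Units.val_pow_eq_pow_val, Units.val_mk0, Units.val_one] at key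
  rw [← Finite.injective_iff_bijective, Ne, ← key]
  constructor
  · rintro hinj ⟨y, hy⟩
    have hy' : (y : F) ^ (q ^ m - 1) = a := by simpa using congrArg Units.val hy
    refine y.ne_zero (hinj ?_)
    simp only [zero_pow hqm, mul_zero, sub_zero]
    rw [← pow_sub_one_mul hqm, hy', sub_self]
  · intro h c c' hcc
    by_contra hne
    have hsub : c - c' ≠ 0 := sub_ne_zero.mpr hne
    refine h ⟨Units.mk0 _ hsub, Units.ext ?_⟩
    obtain ⟨p, k, hp, -, rfl⟩ := hq
    have : Fact p.Prime := ⟨hp.nat_prime⟩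
    have : CharP F p := charP_of_card_eq_prime_pow (f := k * n) (by
      rw [hF, pow_mul])
    rw [Units.val_pow_eq_pow_val, Units.val_mk0, Units.val_mk0]
    apply mul_right_cancel₀ hsub
    rw [pow_sub_one_mul hqm, ← pow_mul, sub_pow_char_pow, pow_mul]
    linear_combination hcc
end

section
/- Let q be a prime power, n ≥ 2, and 1 ≤ m ≤ n − 1. Let F be a finite field with q^n elements, a ∈ F with a ≠ 0, d = gcd(m, n), and suppose N := a^{(q^n − 1)/(q^d − 1)} ≠ 1. Then for every c ∈ F, writing L(c) = c^{q^m} − a·c, one has (N/(1 − N)) · Σ_{i=1}^{n/d} a^{−(q^{i m} − 1)/(q^m − 1)} · (L(c))^{q^{(i−1)m}} = c. (Here a^{−k} denotes the k-th power of the inverse of a in F*.) -/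
/-- Multiplying the index by `l` coprime to `k` permutes the factors of a product over one period
of a `k`-periodic function. -/
theorem prod_range_mul_left_of_coprime {M : Type*} [CommMonoid M] {k l : ℕ} (f : ℕ → M)
    (hf : ∀ j, f (j % k) = f j) (h : Nat.Coprime l k) :
    ∏ j ∈ Finset.range k, f (l * j) = ∏ j ∈ Finset.range k, f j := by
  have hmaps : Set.MapsTo (fun j => l * j % k) (Finset.range k : Set ℕ) (Finset.range k) := by
    intro j hj
    simp only [Finset.coe_range, Set.mem_Iio] at hj ⊢
    exact Nat.mod_lt _ (by omega)
  have hinj : Set.InjOn (fun j => l * j % k) (Finset.range k : Set ℕ) := by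
    intro i hi j hj hij
    simp only [Finset.coe_range, Set.mem_Iio] at hi hj
    have hmod : i ≡ j [MOD k] := Nat.ModEq.cancel_left_of_coprime h.symm hij
    exact hmod.eq_of_lt_of_lt hi hj
  exact Finset.prod_nbij (fun j => l * j % k) hmaps hinj
    (Finset.surjOn_of_injOn_of_card_le _ hmaps hinj le_rfl) fun j _ => (hf _).symm

theorem pow_geom_eq_prod {M : Type*} [CommMonoid M] {q e : ℕ} (hq : 2 ≤ q) (he : 0 < e)
    (a : M) (k : ℕ) :
    a ^ ((q ^ (k * e) - 1) / (q ^ e - 1)) = ∏ j ∈ Finset.range k, a ^ q ^ (e * j) := by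
  have hqe : 2 ≤ q ^ e := hq.trans (Nat.le_self_pow he.ne' q)
  rw [mul_comm, pow_mul, ← Nat.geomSum_eq hqe, ← Finset.prod_pow_eq_pow_sum]
  simp only [pow_mul]

theorem sub_pow_pow_of_card {F : Type*} [Field F] [Fintype F] {q n : ℕ} (hq : IsPrimePow q)
    (hF : Fintype.card F = q ^ n) (x y : F) (t : ℕ) :
    (x - y) ^ q ^ t = x ^ q ^ t - y ^ q ^ t := by
  obtain ⟨p, r, hp, -, rfl⟩ := hq
  have : Fact p.Prime := ⟨hp.nat_prime⟩
  rw [← pow_mul] at hF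
  have : CharP F p := charP_of_card_eq_prime_pow hF
  rw [← pow_mul, sub_pow_char_pow]

theorem sum_inv_pow_mul_sub_pow {F : Type*} [Field F] [Fintype F] {q n m : ℕ} (hq : IsPrimePow q)
    (hF : Fintype.card F = q ^ n) {a : F} (ha : a ≠ 0) (hm : 0 < m) (c : F) (k : ℕ) :
    ∑ i ∈ Finset.Icc 1 k, a⁻¹ ^ ((q ^ (i * m) - 1) / (q ^ m - 1)) *
        (c ^ q ^ m - a * c) ^ q ^ ((i - 1) * m) =
      a⁻¹ ^ ((q ^ (k * m) - 1) / (q ^ m - 1)) * c ^ q ^ (k * m) - c := by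
  induction k with
  | zero => simp
  | succ k ih =>
    rw [Finset.sum_Icc_succ_top (by omega), ih, Nat.add_sub_cancel, sub_pow_pow_of_card hq hF,
      mul_pow, ← pow_mul, ← pow_add, show m + k * m = (k + 1) * m by ring,
      pow_geom_eq_prod hq.two_le hm, pow_geom_eq_prod hq.two_le hm,
      Finset.prod_range_succ, mul_comm m k, inv_pow _ (q ^ (k * m))]
    have h : a ^ q ^ (k * m) ≠ 0 := pow_ne_zero _ ha
    field_simp
    ring


/-- Explicit compositional inverse of the linearized permutation binomial
`L(x) = x^{q^m} - a x` on `F = 𝔽_{q^n}`. -/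
theorem stmt_3 (q n m : ℕ) (hq : IsPrimePow q) (hn : 2 ≤ n) (hm1 : 1 ≤ m)
    (hm2 : m ≤ n - 1)
    (F : Type*) [Field F] [Fintype F] (hF : Fintype.card F = q ^ n)
    (a : F) (ha : a ≠ 0) (d : ℕ) (hd : d = Nat.gcd m n)
    (N : F) (hN : N = a ^ ((q ^ n - 1) / (q ^ d - 1))) (hN1 : N ≠ 1) :
    ∀ c : F,
      (N / (1 - N)) *
        ∑ i ∈ Finset.Icc 1 (n / d),
          (a⁻¹) ^ ((q ^ (i * m) - 1) / (q ^ m - 1)) *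
            (c ^ (q ^ m) - a * c) ^ (q ^ ((i - 1) * m)) = c := by
  intro c
  have hq2 : 2 ≤ q := hq.two_le
  subst hd
  set d := Nat.gcd m n with hd
  have hdpos : 0 < d := Nat.gcd_pos_of_pos_left _ hm1
  obtain ⟨k, hk⟩ : d ∣ n := Nat.gcd_dvd_right m n
  obtain ⟨l, hl⟩ : d ∣ m := Nat.gcd_dvd_left m n
  have hnd : n / d = k := Nat.div_eq_of_eq_mul_right hdpos hk
  have hcop : Nat.Coprime l k := by
    have h := Nat.coprime_div_gcd_div_gcd (m := m) (n := n) hdpos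
    rwa [← hd, hnd, Nat.div_eq_of_eq_mul_right hdpos hl] at h
  have hcard : ∀ (x : F) (t : ℕ), x ^ q ^ (n * t) = x := fun x t => by
    rw [pow_mul, ← hF, FiniteField.pow_card_pow]
  have hnorm : N = a ^ ((q ^ (k * m) - 1) / (q ^ m - 1)) := by
    have hper : ∀ j, a ^ q ^ (d * (j % k)) = a ^ q ^ (d * j) := fun j => by
      conv_rhs => rw [← Nat.mod_add_div j k, mul_add, ← mul_assoc, ← hk, pow_add, pow_mul]
      rw [hcard]
    rw [hN, show q ^ n = q ^ (k * d) by rw [hk, mul_comm],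
      pow_geom_eq_prod hq2 hdpos, pow_geom_eq_prod hq2 hm1,
      ← prod_range_mul_left_of_coprime (fun j => a ^ q ^ (d * j)) hper hcop]
    refine Finset.prod_congr rfl fun j _ => ?_
    simp only [hl]
    ring_nf
  have hsum := sum_inv_pow_mul_sub_pow hq hF ha hm1 c k
  have hck : c ^ q ^ (k * m) = c := by
    rw [show k * m = n * l by rw [hl, hk]; ring, hcard]
  rw [hnd, hsum, hck, inv_pow, ← hnorm]
  have hN0 : N ≠ 0 := by rw [hN]; exact pow_ne_zero _ ha
  have h1N : 1 - N ≠ 0 := sub_ne_zero.mpr hN1.symm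
  field_simp
end

section
/- Let q be a prime power, n, m, s, t positive integers with s·t = q^m − 1, d = gcd(m, n), s̄ = gcd(s, q^n − 1), and u = gcd(t, (q^n − 1)/s̄). Let F be a finite field with q^n elements and a ∈ F with a^{(q^n − 1)/s̄} ≠ 1. Then for every y ∈ F with y ≠ 0, ((a·y^{−s})^{(q^n − 1)/(q^d − 1)})^u = a^{(q^n − 1)/s̄}; in particular (y^s)^{(q^n − 1)/(q^d − 1)} ≠ a^{(q^n − 1)/(q^d − 1)}. -/
/-- Splitting off the part of `gcd (s * t) Q` that comes from `s`. -/
theorem Nat.gcd_mul_gcd_div_gcd {s t Q : ℕ} (hQ : 0 < Q) :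
    s.gcd Q * t.gcd (Q / s.gcd Q) = (s * t).gcd Q := by
  have hpos : 0 < s.gcd Q := Nat.gcd_pos_of_pos_right _ hQ
  have hcop : (s / s.gcd Q).Coprime (Q / s.gcd Q) := Nat.coprime_div_gcd_div_gcd hpos
  rw [← hcop.gcd_mul_left_cancel t, ← Nat.gcd_mul_left, ← mul_assoc,
    Nat.mul_div_cancel' (Nat.gcd_dvd_left s Q), Nat.mul_div_cancel' (Nat.gcd_dvd_right s Q)]

/-- For `a` with `a^{(q^n-1)/s̄} ≠ 1` and any `y ∈ F*`,
`(N_{q^n/q^d}(a y^{-s}))^u = a^{(q^n-1)/s̄}`; in particular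
`N_{q^n/q^d}(y^s) ≠ N_{q^n/q^d}(a)`. -/
theorem stmt_5 (q n m s t : ℕ) (hq : IsPrimePow q) (hn : 0 < n) (hm : 0 < m)
    (hs : 0 < s) (ht : 0 < t) (hst : s * t = q ^ m - 1)
    (d sb u : ℕ) (hd : d = Nat.gcd m n) (hsb : sb = Nat.gcd s (q ^ n - 1))
    (hu : u = Nat.gcd t ((q ^ n - 1) / sb))
    (F : Type*) [Field F] [Fintype F] (hF : Fintype.card F = q ^ n)
    (a : F) (ha : a ^ ((q ^ n - 1) / sb) ≠ 1) :
    ∀ y : F, y ≠ 0 →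
      ((a * (y⁻¹) ^ s) ^ ((q ^ n - 1) / (q ^ d - 1))) ^ u =
          a ^ ((q ^ n - 1) / sb) ∧
        (y ^ s) ^ ((q ^ n - 1) / (q ^ d - 1)) ≠
          a ^ ((q ^ n - 1) / (q ^ d - 1)) := by
  intro y hy
  have hq1 : 1 < q := hq.one_lt
  have hQ : 0 < q ^ n - 1 := Nat.sub_pos_of_lt (Nat.one_lt_pow hn.ne' hq1)
  have hfac : sb * u = q ^ d - 1 := by
    rw [hu, hsb, Nat.gcd_mul_gcd_div_gcd hQ, hst, hd, Nat.pow_sub_one_gcd_pow_sub_one]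
  have hdvd : sb * u ∣ q ^ n - 1 := by
    rw [hfac, hd, ← Nat.pow_sub_one_gcd_pow_sub_one]
    exact Nat.gcd_dvd_right _ _
  have hexp : (q ^ n - 1) / (q ^ d - 1) * u = (q ^ n - 1) / sb := by
    rw [← hfac, ← Nat.div_div_eq_div_mul]
    exact Nat.div_mul_cancel (Nat.dvd_div_of_mul_dvd hdvd)
  have hone : (y ^ s) ^ ((q ^ n - 1) / sb) = 1 := by
    have hsQ : s * ((q ^ n - 1) / sb) = (q ^ n - 1) * (s / sb) := by
      rw [← Nat.mul_div_assoc _ (hsb ▸ Nat.gcd_dvd_right _ _),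
        ← Nat.mul_div_assoc _ (hsb ▸ Nat.gcd_dvd_left _ _), mul_comm]
    rw [← pow_mul, hsQ, pow_mul, ← hF, FiniteField.pow_card_sub_one_eq_one y hy, one_pow]
  refine ⟨?_, fun h => ha ?_⟩
  · rw [← pow_mul, hexp, mul_pow, inv_pow, inv_pow, hone, inv_one, mul_one]
  · rw [← hexp, pow_mul, ← h, ← pow_mul, hexp, hone]
end

section
/- Let q be a prime power, n, m, s, t positive integers with s·t = q^m − 1, let F be a finite field with q^n elements, and let a ∈ F, a ≠ 0, with s̄ = gcd(s, q^n − 1) and a^{(q^n − 1)/s̄} ≠ 1, so that f(c) = c·(c^s − a)^t is a bijection of F. Set d = gcd(m, n) and, for x ∈ F, define N(x) = x^{(q^n − 1)/(q^d − 1)}. Then for every c ∈ F, writing y = f(c), one has y · ( (N(a)/(N(y^s) − N(a))) · Σ_{i=1}^{n/d} a^{−(q^{i m} − 1)/(q^m − 1)} · y^{(q^{(i−1)m} − 1)/t} )^t = c. (Here a^{−k} denotes the k-th power of the inverse of a in F*, the exponents (q^{i m} − 1)/(q^m − 1) and (q^{(i−1)m} − 1)/t are integers, and N(y^s) − N(a)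 ≠ 0 for every y ∈ F.) -/
open Finset in
theorem prod_range_pow_mul_eq_of_coprime {M : Type*} [CommMonoid M] {Q k r : ℕ} (hk : 0 < k)
    (hr : Nat.Coprime k r) {x : M} (hx : x ^ Q ^ k = x) :
    ∏ j ∈ range k, x ^ Q ^ (r * j) = ∏ j ∈ range k, x ^ Q ^ j := by
  have hmul : ∀ l, x ^ Q ^ (k * l) = x := by
    intro l
    induction l with
    | zero => simp
    | succ l ih => rw [mul_add, pow_add, pow_mul, ih, mul_one, hx]
  have hmod : ∀ j, x ^ Q ^ j = x ^ Q ^ (j % k) := by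
    intro j
    conv_lhs => rw [← Nat.div_add_mod j k, pow_add, pow_mul, hmul]
  have hmaps : ∀ j ∈ range k, r * j % k ∈ range k := fun j _ => mem_range.2 (Nat.mod_lt _ hk)
  have hinj : Set.InjOn (fun j => r * j % k) (range k) := by
    intro i hi j hj hij
    have h : i ≡ j [MOD k] := Nat.ModEq.cancel_left_of_coprime hr hij
    exact h.eq_of_lt_of_lt (by simpa using hi) (by simpa using hj)
  exact prod_nbij (fun j => r * j % k) hmaps hinj
    (surjOn_of_injOn_of_card_le _ hmaps hinj le_rfl) fun j _ => hmod _

open Finset in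
theorem pow_geomSum_eq_pow_div {F : Type*} [Field F] [Fintype F] {q n m : ℕ} (hq : 2 ≤ q)
    (hn : 0 < n) (hF : Fintype.card F = q ^ n) (x : F) :
    x ^ (∑ j ∈ range (n / m.gcd n), (q ^ m) ^ j) =
      x ^ ((q ^ n - 1) / (q ^ m.gcd n - 1)) := by
  have hd : 0 < m.gcd n := Nat.gcd_pos_of_pos_right m hn
  have hm : m = m.gcd n * (m / m.gcd n) := (Nat.mul_div_cancel' (Nat.gcd_dvd_left m n)).symm
  have hnd : m.gcd n * (n / m.gcd n) = n := Nat.mul_div_cancel' (Nat.gcd_dvd_right m n)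
  have hcop : (n / m.gcd n).Coprime (m / m.gcd n) := (Nat.coprime_div_gcd_div_gcd hd).symm
  have hk : 0 < n / m.gcd n := Nat.div_pos (Nat.gcd_le_right m hn) hd
  generalize m.gcd n = d at *
  generalize n / d = k at *
  generalize m / d = r at *
  subst hm hnd
  have hx : x ^ (q ^ d) ^ k = x := by rw [← pow_mul, ← hF, FiniteField.pow_card]
  rw [pow_mul q d k, ← Nat.geomSum_eq (le_trans hq (Nat.le_self_pow hd.ne' q)),
    ← prod_pow_eq_pow_sum, ← prod_pow_eq_pow_sum,
    ← prod_range_pow_mul_eq_of_coprime hk hcop hx]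
  simp only [pow_mul]

/-- The solution of `a u = z u ^ Q - 1` obtained by substituting the equation into itself,
for `Q` a power of the characteristic. -/
theorem eq_pow_geomSum_mul_sub_sum {F : Type*} [Field F] {Q : ℕ}
    (hsub : ∀ (k : ℕ) (x y : F), (x - y) ^ Q ^ k = x ^ Q ^ k - y ^ Q ^ k)
    {a z u : F} (ha : a ≠ 0) (hu : a * u = z * u ^ Q - 1) (k : ℕ) :
    u = (z / a) ^ (∑ j ∈ Finset.range k, Q ^ j) * u ^ Q ^ k -
      ∑ i ∈ Finset.Icc 1 k, a⁻¹ ^ (∑ j ∈ Finset.range i, Q ^ j) *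
        z ^ (∑ j ∈ Finset.range (i - 1), Q ^ j) := by
  have hu' : u = z / a * u ^ Q - a⁻¹ := by
    field_simp
    linear_combination hu
  induction k with
  | zero => simp
  | succ k ih =>
    have hpow : u ^ Q ^ k = (z / a) ^ Q ^ k * u ^ Q ^ (k + 1) - a⁻¹ ^ Q ^ k := by
      conv_lhs => rw [hu', hsub, mul_pow, ← pow_mul, ← pow_succ']
    rw [Finset.sum_Icc_succ_top (by omega), Nat.add_sub_cancel, Finset.sum_range_succ, pow_add,
      pow_add]
    rw [hpow, mul_sub] at ih
    rw [div_eq_mul_inv, mul_pow, mul_pow] at ih ⊢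
    linear_combination ih


/-- Explicit compositional inverse of the permutation `f(x) = x (x^s - a)^t`
of `F = 𝔽_{q^n}`, where `st = q^m - 1` and `a` is not an `s`-th power. -/
theorem stmt_6 (q n m s t : ℕ) (hq : IsPrimePow q) (hn : 0 < n) (hm : 0 < m)
    (hs : 0 < s) (ht : 0 < t) (hst : s * t = q ^ m - 1)
    (F : Type*) [Field F] [Fintype F] (hF : Fintype.card F = q ^ n)
    (a : F) (ha : a ≠ 0)
    (sb d : ℕ) (hsb : sb = Nat.gcd s (q ^ n - 1)) (hd : d = Nat.gcd m n)
    (hpp : a ^ ((q ^ n - 1) / sb) ≠ 1)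
    (f : F → F) (hf : ∀ c, f c = c * (c ^ s - a) ^ t)
    (N : F → F) (hN : ∀ x, N x = x ^ ((q ^ n - 1) / (q ^ d - 1))) :
    (∀ y : F, N (y ^ s) - N a ≠ 0) ∧
      ∀ c : F,
        f c *
          ((N a / (N (f c ^ s) - N a)) *
            ∑ i ∈ Finset.Icc 1 (n / d),
              (a⁻¹) ^ ((q ^ (i * m) - 1) / (q ^ m - 1)) *
                (f c) ^ ((q ^ ((i - 1) * m) - 1) / t)) ^ t = c := by
  have hq2 : 2 ≤ q := hq.two_le
  have hd0 : 0 < d := hd ▸ Nat.gcd_pos_of_pos_right m hn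
  have hQ2 : 2 ≤ q ^ m := hq2.trans (Nat.le_self_pow hm.ne' q)
  have hqd : 0 < q ^ d - 1 := Nat.sub_pos_of_lt (Nat.one_lt_pow hd0.ne' hq2)
  have hdvd : q ^ d - 1 ∣ q ^ n - 1 :=
    Nat.pow_sub_one_dvd_pow_sub_one q (hd ▸ Nat.gcd_dvd_right m n)
  have hqn : 0 < q ^ n - 1 := Nat.sub_pos_of_lt (Nat.one_lt_pow hn.ne' hq2)
  have hsbd : sb ∣ q ^ d - 1 := by
    rw [hd, ← Nat.pow_sub_one_gcd_pow_sub_one, hsb]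
    exact Nat.gcd_dvd_gcd_of_dvd_left _ (hst ▸ Dvd.intro t rfl)
  have hsbs : sb ∣ s := hsb ▸ Nat.gcd_dvd_left _ _
  have hNa : N a ≠ 0 := by rw [hN]; exact pow_ne_zero _ ha
  have hnorm : ∀ y : F, N (y ^ s) - N a ≠ 0 := by
    intro y hy
    rw [sub_eq_zero] at hy
    have hy0 : y ≠ 0 := by
      rintro rfl
      rw [hN, zero_pow hs.ne', zero_pow (Nat.div_pos (Nat.le_of_dvd hqn hdvd) hqd).ne'] at hy
      exact hNa hy.symm
    have hexp : (q ^ n - 1) / (q ^ d - 1) * ((q ^ d - 1) / sb) = (q ^ n - 1) / sb := by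
      rw [← Nat.mul_div_assoc _ hsbd, Nat.div_mul_cancel hdvd]
    have hpow := congrArg (· ^ ((q ^ d - 1) / sb)) hy
    simp only [hN, ← pow_mul, hexp, mul_assoc] at hpow
    rw [← Nat.mul_div_assoc _ (hsbd.trans hdvd), mul_comm, Nat.mul_div_assoc _ hsbs, pow_mul,
      ← hF, FiniteField.pow_card_sub_one_eq_one y hy0, one_pow, hF] at hpow
    exact hpp hpow.symm
  refine ⟨hnorm, fun c => ?_⟩
  have hw : c ^ s - a ≠ 0 := fun h => hnorm c (by rw [sub_eq_zero.1 h, sub_self])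
  have hu : a * (c ^ s - a)⁻¹ = f c ^ s * (c ^ s - a)⁻¹ ^ q ^ m - 1 := by
    obtain ⟨e, he⟩ : ∃ e, q ^ m = e + 1 := ⟨q ^ m - 1, by omega⟩
    rw [hf, mul_pow, ← pow_mul, mul_comm t, hst, he, Nat.add_sub_cancel, pow_succ, inv_pow]
    field_simp
    ring
  have hsub : ∀ (k : ℕ) (x y : F),
      (x - y) ^ (q ^ m) ^ k = x ^ (q ^ m) ^ k - y ^ (q ^ m) ^ k := by
    obtain ⟨p, r, hp, hr, rfl⟩ := hq
    have : Fact p.Prime := ⟨hp.nat_prime⟩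
    have : CharP F p := charP_of_card_eq_prime_pow (f := r * n) (by
      rw [pow_mul, ← hF, Fintype.card_eq_nat_card])
    intro k x y
    simp only [← pow_mul]
    exact sub_pow_char_pow x y _
  have hfix : ∀ x : F, x ^ (q ^ m) ^ (n / d) = x := by
    intro x
    have h : m * (n / d) = n * (m / d) := by
      rw [← Nat.mul_div_assoc _ (hd ▸ Nat.gcd_dvd_right m n),
        ← Nat.mul_div_assoc _ (hd ▸ Nat.gcd_dvd_left m n), mul_comm]
    rw [← pow_mul, h, pow_mul, ← hF, FiniteField.pow_card_pow]
  have hterm : ∀ i ∈ Finset.Icc 1 (n / d),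
      (a⁻¹) ^ ((q ^ (i * m) - 1) / (q ^ m - 1)) * f c ^ ((q ^ ((i - 1) * m) - 1) / t) =
        a⁻¹ ^ (∑ j ∈ Finset.range i, (q ^ m) ^ j) *
          (f c ^ s) ^ (∑ j ∈ Finset.range (i - 1), (q ^ m) ^ j) := by
    intro i _
    have h : (q ^ ((i - 1) * m) - 1) / t = s * ∑ j ∈ Finset.range (i - 1), (q ^ m) ^ j := by
      apply Nat.div_eq_of_eq_mul_left ht
      rw [mul_right_comm, hst, mul_comm (i - 1), pow_mul, mul_comm, Nat.geomSum_eq hQ2]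
      exact (Nat.div_mul_cancel (by simpa using Nat.sub_dvd_pow_sub_pow (q ^ m) 1 (i - 1))).symm
    rw [h, pow_mul (f c), Nat.geomSum_eq hQ2 i, mul_comm i, pow_mul q]
  have hsolve := eq_pow_geomSum_mul_sub_sum hsub ha hu (n / d)
  rw [hfix, ← Finset.sum_congr rfl hterm, div_pow] at hsolve
  have hG : ∀ x : F, x ^ (∑ j ∈ Finset.range (n / d), (q ^ m) ^ j) = N x := by
    intro x
    rw [hN, hd, pow_geomSum_eq_pow_div hq2 hn hF]
  rw [hG, hG] at hsolve
  have hinv : N a / (N (f c ^ s) - N a) *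
      ∑ i ∈ Finset.Icc 1 (n / d), (a⁻¹) ^ ((q ^ (i * m) - 1) / (q ^ m - 1)) *
        f c ^ ((q ^ ((i - 1) * m) - 1) / t) = (c ^ s - a)⁻¹ := by
    have hne := hnorm (f c)
    generalize (c ^ s - a)⁻¹ = u at hsolve ⊢
    generalize N (f c ^ s) = z at hsolve hne ⊢
    generalize (∑ i ∈ Finset.Icc 1 (n / d), (_ : F)) = S at hsolve ⊢
    field_simp at hsolve ⊢
    linear_combination hsolve
  rw [hinv, inv_pow, hf, mul_assoc, mul_inv_cancel₀ (pow_ne_zero t hw), mul_one]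
end

section
/- Let q be a prime power, n, m, s, t positive integers with s·t = q^m − 1, let F be a finite field with q^n elements, and let a ∈ F, a ≠ 0, with s̄ = gcd(s, q^n − 1) and a^{(q^n − 1)/s̄} ≠ 1, so that f(c) = c·(c^s − a)^t is a bijection of F. Set d = gcd(m, n), u = gcd(t, (q^n − 1)/s̄), and for x ∈ F define N(x) = x^{(q^n − 1)/(q^d − 1)}. Define A = N(a)/(1 − a^{(q^n − 1)/s̄}), g(x) = Σ_{ℓ=1}^{u} N(a)^{u−ℓ} · x^{((q^n − 1)/(q^d − 1))·s·(ℓ−1)}, and h(x) = Σ_{i=1}^{n/d} a^{−(q^{i m} − 1)/(q^m − 1)} · x^{(q^{(i−1)m} − 1)/t}. Then for every c ∈ F, one has f(c) · (A · g(f(c)) · h(f(c)))^t = c. -/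
/-- In a field of `q ^ n` elements, `x ^ (q ^ i)` only depends on `i` modulo `n`. -/
theorem FiniteField.pow_pow_mod {F : Type*} [Field F] [Fintype F] {q n : ℕ}
    (hF : Fintype.card F = q ^ n) (x : F) (i : ℕ) : x ^ q ^ (i % n) = x ^ q ^ i := by
  conv_rhs => rw [← Nat.div_add_mod i n, pow_add, pow_mul q, pow_mul, ← hF,
    FiniteField.pow_card_pow]

/-- Multiplication by an integer coprime to `k` permutes the residues modulo `k`. -/
theorem Finset.prod_range_mul_mod {M : Type*} [CommMonoid M] {k r : ℕ} (hk : 0 < k)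
    (hr : Nat.Coprime k r) (φ : ℕ → M) :
    ∏ j ∈ Finset.range k, φ (r * j % k) = ∏ j ∈ Finset.range k, φ j := by
  have hmaps : Set.MapsTo (fun j => r * j % k) (Finset.range k : Set ℕ) (Finset.range k) :=
    fun j _ => by simpa using Nat.mod_lt _ hk
  have hinj : Set.InjOn (fun j => r * j % k) (Finset.range k : Set ℕ) := by
    intro i hi j hj hij
    have hmod : i ≡ j [MOD k] := Nat.ModEq.cancel_left_of_coprime hr hij
    exact hmod.eq_of_lt_of_lt (by simpa using hi) (by simpa using hj)
  exact Finset.prod_nbij _ (fun j hj => hmaps hj) hinj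
    (Finset.surjOn_of_injOn_of_card_le _ hmaps hinj le_rfl) fun _ _ => rfl

/-- The norm exponent to the subfield of `q ^ gcd m n` elements can be computed with
any generator `x ↦ x ^ (q ^ m)` of the Galois group. -/
theorem FiniteField.pow_norm_exponent {F : Type*} [Field F] [Fintype F] {q n m : ℕ}
    (hq : 2 ≤ q) (hn : 0 < n) (hm : 0 < m) (hF : Fintype.card F = q ^ n) (x : F) :
    x ^ (∑ j ∈ Finset.range (n / Nat.gcd m n), (q ^ m) ^ j) =
      x ^ ((q ^ n - 1) / (q ^ Nat.gcd m n - 1)) := by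
  set d := Nat.gcd m n with hd
  have hdpos : 0 < d := Nat.gcd_pos_of_pos_left _ hm
  obtain ⟨k, hk⟩ : d ∣ n := Nat.gcd_dvd_right m n
  obtain ⟨r, hr⟩ : d ∣ m := Nat.gcd_dvd_left m n
  have hkdiv : n / d = k := by rw [hk, Nat.mul_div_cancel_left _ hdpos]
  have hrdiv : m / d = r := by rw [hr, Nat.mul_div_cancel_left _ hdpos]
  have hkpos : 0 < k := Nat.pos_of_ne_zero (by rintro rfl; simp at hk; omega)
  have hco : Nat.Coprime k r := by
    rw [← hkdiv, ← hrdiv]; exact (Nat.coprime_div_gcd_div_gcd hdpos).symm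
  have hgeom : (q ^ n - 1) / (q ^ d - 1) = ∑ j ∈ Finset.range k, (q ^ d) ^ j := by
    rw [Nat.geomSum_eq (hq.trans (Nat.le_self_pow hdpos.ne' q)), ← pow_mul, ← hk]
  rw [hkdiv, hgeom, ← Finset.prod_pow_eq_pow_sum, ← Finset.prod_pow_eq_pow_sum,
    ← Finset.prod_range_mul_mod hkpos hco fun j => x ^ (q ^ d) ^ j]
  refine Finset.prod_congr rfl fun j _ => ?_
  rw [← pow_mul, ← pow_mul, ← Nat.mul_mod_mul_left d, ← hk, ← mul_assoc, ← hr,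
    FiniteField.pow_pow_mod hF]

/-- Iterating the affine `Q`-polynomial relation `a v = Y v ^ Q - 1`. -/
theorem eq_sub_sum_of_mul_eq_mul_pow_sub_one {F : Type*} [Field F] {Q : ℕ}
    (hQ : ∀ (k : ℕ) (x y : F), (x - y) ^ Q ^ k = x ^ Q ^ k - y ^ Q ^ k)
    {a v Y : F} (ha : a ≠ 0) (hv : a * v = Y * v ^ Q - 1) (k : ℕ) :
    v = (a⁻¹) ^ (∑ j ∈ Finset.range k, Q ^ j) * Y ^ (∑ j ∈ Finset.range k, Q ^ j) * v ^ Q ^ k -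
      ∑ i ∈ Finset.range k, (a⁻¹) ^ (∑ j ∈ Finset.range (i + 1), Q ^ j) *
        Y ^ (∑ j ∈ Finset.range i, Q ^ j) := by
  induction k with
  | zero => simp
  | succ k ih =>
    have hstep : v ^ Q ^ k = (a⁻¹) ^ Q ^ k * (Y ^ Q ^ k * v ^ Q ^ (k + 1) - 1) := by
      have h1 : v = a⁻¹ * (Y * v ^ Q - 1) := by rw [← hv, inv_mul_cancel_left₀ ha]
      conv_lhs => rw [h1]
      rw [mul_pow, hQ, mul_pow, one_pow, ← pow_mul, ← pow_succ']
    conv_lhs => rw [ih, hstep]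
    simp only [Finset.sum_range_succ, pow_add]
    ring

theorem Finset.sum_Icc_one_eq_sum_range {M : Type*} [AddCommMonoid M] (φ : ℕ → M) (n : ℕ) :
    ∑ i ∈ Finset.Icc 1 n, φ i = ∑ i ∈ Finset.range n, φ (i + 1) := by
  rw [Finset.range_eq_Ico, Finset.sum_Ico_add', zero_add, Finset.Ico_add_one_right_eq_Icc]

theorem Nat.gcd_mul_gcd_div_gcd_s7 (s t M : ℕ) :
    Nat.gcd t (M / Nat.gcd s M) * Nat.gcd s M = Nat.gcd (s * t) M := by
  rw [← Nat.gcd_mul_right, Nat.div_mul_cancel (Nat.gcd_dvd_right s M), ← Nat.gcd_mul_left,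
    Nat.gcd_assoc, Nat.gcd_mul_left_left, mul_comm]

/-- The inverse of the permutation `f(x) = x (x^s - a)^t` of `F = 𝔽_{q^n}`
can be written as `x (A g(x) h(x))^t`. -/
theorem stmt_7 (q n m s t : ℕ) (hq : IsPrimePow q) (hn : 0 < n) (hm : 0 < m)
    (hs : 0 < s) (ht : 0 < t) (hst : s * t = q ^ m - 1)
    (F : Type*) [Field F] [Fintype F] (hF : Fintype.card F = q ^ n)
    (a : F) (ha : a ≠ 0)
    (sb d u : ℕ) (hsb : sb = Nat.gcd s (q ^ n - 1)) (hd : d = Nat.gcd m n)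
    (hu : u = Nat.gcd t ((q ^ n - 1) / sb))
    (hpp : a ^ ((q ^ n - 1) / sb) ≠ 1)
    (f : F → F) (hf : ∀ c, f c = c * (c ^ s - a) ^ t)
    (N : F → F) (hN : ∀ x, N x = x ^ ((q ^ n - 1) / (q ^ d - 1)))
    (A : F) (hA : A = N a / (1 - a ^ ((q ^ n - 1) / sb)))
    (g : F → F)
    (hg : ∀ x, g x = ∑ l ∈ Finset.Icc 1 u,
      (N a) ^ (u - l) * x ^ (((q ^ n - 1) / (q ^ d - 1)) * s * (l - 1)))
    (h : F → F)
    (hh : ∀ x, h x = ∑ i ∈ Finset.Icc 1 (n / d),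
      (a⁻¹) ^ ((q ^ (i * m) - 1) / (q ^ m - 1)) *
        x ^ ((q ^ ((i - 1) * m) - 1) / t)) :
    ∀ c : F, f c * (A * g (f c) * h (f c)) ^ t = c := by
  intro c
  have hq2 : 2 ≤ q := hq.two_le
  have hQ2 : 2 ≤ q ^ m := hq2.trans (Nat.le_self_pow hm.ne' q)
  have hsub (k : ℕ) (x y : F) : (x - y) ^ (q ^ m) ^ k = x ^ (q ^ m) ^ k - y ^ (q ^ m) ^ k := by
    obtain ⟨p, e, hp, -, rfl⟩ := hq
    have : Fact p.Prime := ⟨hp.nat_prime⟩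
    have : CharP F p := charP_of_card_eq_prime_pow (hF.trans (pow_mul p e n).symm)
    rw [← pow_mul, ← pow_mul]
    exact sub_pow_char_pow x y _
  rcases eq_or_ne c 0 with rfl | hc
  · simp [hf]
  have hM : 0 < q ^ n - 1 := Nat.sub_pos_of_lt (Nat.one_lt_pow hn.ne' hq2)
  have hunit (x : F) (hx : x ≠ 0) : x ^ (q ^ n - 1) = 1 := by
    rw [← hF]; exact FiniteField.pow_card_sub_one_eq_one x hx
  have hsbM : sb ∣ q ^ n - 1 := hsb ▸ Nat.gcd_dvd_right _ _
  have hsbs : sb ∣ s := hsb ▸ Nat.gcd_dvd_left _ _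
  have hsbpos : 0 < sb := Nat.pos_of_dvd_of_pos hsbM hM
  have hus : u * sb = q ^ d - 1 := by
    rw [hu, hsb, hd, Nat.gcd_mul_gcd_div_gcd_s7, hst, Nat.pow_sub_one_gcd_pow_sub_one]
  have hdM : q ^ d - 1 ∣ q ^ n - 1 := by
    rw [hd, ← Nat.pow_sub_one_gcd_pow_sub_one]; exact Nat.gcd_dvd_right _ _
  have hexp : (q ^ n - 1) / (q ^ d - 1) * u = (q ^ n - 1) / sb := by
    refine (Nat.div_eq_of_eq_mul_left hsbpos ?_).symm
    rw [mul_assoc, hus, Nat.div_mul_cancel hdM]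
  have hs_pow (x : F) (hx : x ≠ 0) : (x ^ s) ^ ((q ^ n - 1) / sb) = 1 := by
    obtain ⟨r, hr⟩ := hsbs
    rw [hr, ← pow_mul, mul_right_comm, Nat.mul_div_cancel' hsbM, pow_mul, hunit x hx, one_pow]
  have hw : c ^ s - a ≠ 0 := fun h0 => hpp (by rw [← sub_eq_zero.mp h0, hs_pow c hc])
  set w := c ^ s - a with hw_def
  set y := f c with hy
  have hyw : y = c * w ^ t := hf c
  have hy0 : y ≠ 0 := hyw ▸ mul_ne_zero hc (pow_ne_zero _ hw)
  have hv : a * w⁻¹ = y ^ s * w⁻¹ ^ q ^ m - 1 := by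
    have hY : y ^ s * w⁻¹ ^ q ^ m = c ^ s * w⁻¹ := by
      rw [hyw, mul_pow, ← pow_mul, mul_comm t, hst]
      conv_lhs => rw [← Nat.sub_add_cancel (by omega : 1 ≤ q ^ m), Nat.add_sub_cancel, pow_succ,
        mul_assoc, ← mul_assoc (w ^ _), ← mul_pow, mul_inv_cancel₀ hw, one_pow, one_mul]
    rw [hY, show c ^ s = w + a by rw [hw_def]; ring]
    field_simp
    ring
  have hiter := eq_sub_sum_of_mul_eq_mul_pow_sub_one hsub ha hv (n / d)
  have hfix : w⁻¹ ^ (q ^ m) ^ (n / d) = w⁻¹ := by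
    have hmn : m * (n / d) = n * (m / d) := by
      rw [← Nat.mul_div_assoc _ (hd ▸ Nat.gcd_dvd_right m n), mul_comm m n,
        Nat.mul_div_assoc _ (hd ▸ Nat.gcd_dvd_left m n)]
    rw [← pow_mul, hmn, pow_mul, ← hF, FiniteField.pow_card_pow]
  have hnorm (x : F) : x ^ (∑ j ∈ Finset.range (n / d), (q ^ m) ^ j) = N x := by
    rw [hN, hd, FiniteField.pow_norm_exponent hq2 hn hm hF]
  have hhy : h y = ∑ i ∈ Finset.range (n / d),
      (a⁻¹) ^ (∑ j ∈ Finset.range (i + 1), (q ^ m) ^ j) *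
        (y ^ s) ^ (∑ j ∈ Finset.range i, (q ^ m) ^ j) := by
    rw [hh, Finset.sum_Icc_one_eq_sum_range]
    refine Finset.sum_congr rfl fun i _ => ?_
    have hgeom : (q ^ (i * m) - 1) / t = s * ∑ j ∈ Finset.range i, (q ^ m) ^ j := by
      refine Nat.div_eq_of_eq_mul_left ht ?_
      rw [mul_right_comm, hst, Nat.geomSum_eq hQ2, mul_comm i, pow_mul,
        Nat.mul_div_cancel' (Nat.sub_one_dvd_pow_sub_one _ _)]
    rw [Nat.geomSum_eq hQ2, ← pow_mul q, mul_comm m, Nat.add_sub_cancel, hgeom, pow_mul y]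
  rw [hnorm, hnorm, hfix, ← hhy] at hiter
  have hNinv : N a⁻¹ = (N a)⁻¹ := by rw [hN, hN, inv_pow]
  have hNa : N a ≠ 0 := by rw [hN]; exact pow_ne_zero _ ha
  have hNYu : N (y ^ s) ^ u = 1 := by rw [hN, ← pow_mul, hexp, hs_pow y hy0]
  have hNau : N a ^ u = a ^ ((q ^ n - 1) / sb) := by rw [hN, ← pow_mul, hexp]
  have hden : 1 - a ^ ((q ^ n - 1) / sb) ≠ 0 := sub_ne_zero.mpr (Ne.symm hpp)
  have hgy : g y * (N (y ^ s) - N a) = 1 - a ^ ((q ^ n - 1) / sb) := by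
    rw [← hNYu, ← hNau, ← geom_sum₂_mul, hg, Finset.sum_Icc_one_eq_sum_range]
    congr 1
    refine Finset.sum_congr rfl fun l _ => ?_
    rw [Nat.add_sub_cancel, hN (y ^ s), ← pow_mul, ← pow_mul, mul_comm, Nat.sub_sub,
      add_comm 1 l, ← mul_assoc, mul_comm s]
  have hvh : w⁻¹ * (N (y ^ s) - N a) = N a * h y := by
    rw [hNinv] at hiter
    linear_combination -N a * hiter - w⁻¹ * N (y ^ s) * mul_inv_cancel₀ hNa
  have hkey : A * g y * h y = w⁻¹ := by
    rw [hA, div_mul_eq_mul_div, div_mul_eq_mul_div, div_eq_iff hden, ← hgy]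
    linear_combination -g y * hvh
  rw [hkey, hyw, mul_assoc, ← mul_pow, mul_inv_cancel₀ hw, one_pow, mul_one]
end

section
/- Let a be an odd positive integer with a ≥ 3, and let m, n be positive integers with d = gcd(m, n). Then gcd((a^m − 1)/2, a^n − 1) = a^d − 1 if m/d is even, and gcd((a^m − 1)/2, a^n − 1) = (a^d − 1)/2 if m/d is odd. -/
theorem even_geom_sum_iff {b : ℕ} (hb : Odd b) (k : ℕ) :
    Even (∑ i ∈ Finset.range k, b ^ i) ↔ Even k := by
  induction k with
  | zero => simp
  | succ k ih =>
    have hbk : ¬ Even (b ^ k) := Nat.not_even_iff_odd.mpr hb.pow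
    rw [Finset.sum_range_succ, Nat.even_add, ih, Nat.even_add_one]
    tauto

theorem pow_sub_one_eq_mul_geom_sum {b : ℕ} (hb : 1 ≤ b) (k : ℕ) :
    b ^ k - 1 = (b - 1) * ∑ i ∈ Finset.range k, b ^ i := by
  have h := geom_sum_mul_add (b - 1) k
  rw [Nat.sub_add_cancel hb] at h
  rw [← h, Nat.add_sub_cancel, mul_comm]

theorem gcd_half_pow_sub_one {a m n : ℕ} (ha : Odd a) (ha3 : 3 ≤ a) (hm : 0 < m) :
    Nat.gcd ((a ^ m - 1) / 2) (a ^ n - 1) =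
      (a ^ m.gcd n - 1) / 2 *
        Nat.gcd (∑ i ∈ Finset.range (m / m.gcd n), (a ^ m.gcd n) ^ i) 2 := by
  have hgcd := Nat.pow_sub_one_gcd_pow_sub_one a m n
  have hd : 0 < m.gcd n := Nat.gcd_pos_of_pos_left n hm
  have hM : a ^ m = (a ^ m.gcd n) ^ (m / m.gcd n) := by
    rw [← pow_mul, Nat.mul_div_cancel' (Nat.gcd_dvd_left m n)]
  have hN : a ^ n = (a ^ m.gcd n) ^ (n / m.gcd n) := by
    rw [← pow_mul, Nat.mul_div_cancel' (Nat.gcd_dvd_right m n)]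
  have hb : 1 < a ^ m.gcd n := Nat.one_lt_pow hd.ne' (by omega)
  have hodd : Odd (a ^ m.gcd n) := ha.pow
  rw [hM, hN, pow_sub_one_eq_mul_geom_sum hb.le, pow_sub_one_eq_mul_geom_sum hb.le] at hgcd ⊢
  set S := ∑ i ∈ Finset.range (m / m.gcd n), (a ^ m.gcd n) ^ i
  set T := ∑ i ∈ Finset.range (n / m.gcd n), (a ^ m.gcd n) ^ i
  obtain ⟨E, hE⟩ := hodd
  have hD : a ^ m.gcd n - 1 = 2 * E := by omega
  have hST : Nat.Coprime S T := by
    rw [Nat.gcd_mul_left] at hgcd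
    exact Nat.eq_of_mul_eq_mul_left (Nat.sub_pos_of_lt hb) (hgcd.trans (mul_one _).symm)
  rw [hD, mul_assoc, Nat.mul_div_cancel_left _ two_pos, Nat.mul_div_cancel_left _ two_pos,
    mul_comm 2 E, mul_assoc, Nat.gcd_mul_left, hST.symm.gcd_mul_right_cancel_right]

/-- For odd `a ≥ 3` and `d = gcd(m, n)`:
`gcd((a^m - 1)/2, a^n - 1)` equals `a^d - 1` if `m/d` is even,
and `(a^d - 1)/2` if `m/d` is odd. -/
theorem stmt_8 (a m n : ℕ) (ha : Odd a) (ha3 : 3 ≤ a) (hm : 0 < m) (hn : 0 < n)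
    (d : ℕ) (hd : d = Nat.gcd m n) :
    (Even (m / d) → Nat.gcd ((a ^ m - 1) / 2) (a ^ n - 1) = a ^ d - 1) ∧
      (Odd (m / d) →
        Nat.gcd ((a ^ m - 1) / 2) (a ^ n - 1) = (a ^ d - 1) / 2) := by
  subst hd
  rw [gcd_half_pow_sub_one ha ha3 hm]
  have hodd : Odd (a ^ m.gcd n) := ha.pow
  constructor
  · intro hk
    rw [Nat.gcd_eq_right ((even_geom_sum_iff hodd _).mpr hk).two_dvd,
      Nat.div_mul_cancel (Nat.Odd.sub_odd hodd odd_one).two_dvd]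
  · intro hk
    have hS := Nat.not_even_iff_odd.mp
      (mt (even_geom_sum_iff hodd _).mp (Nat.not_even_iff_odd.mpr hk))
    rw [Nat.Coprime.gcd_eq_one (Nat.coprime_two_right.mpr hS), mul_one]
end

section
/- Let q be an odd prime power, n ≥ 2, 1 ≤ m ≤ n − 1, d = gcd(m, n), and suppose m/d is even. Let F be a finite field with q^n elements and a ∈ F, a ≠ 0. For x ∈ F write N(x) = x^{(q^n − 1)/(q^d − 1)}. Then the map f(c) = c^{q^m} − 2a·c^{(q^m + 1)/2} + a^2·c is a bijection of F if and only if N(a) ≠ 1; and in that case, defining b_{ij} = 1 if i = j and b_{ij} = 2 if i < j, and h_2(x) = Σ_{1 ≤ i ≤ j ≤ n/d} a^{−(q^{i m} + q^{j m} − 2)/(q^m − 1)} · b_{ij} · x^{(q^{(i−1)m} + q^{(j−1)m})/2}, one has for every c ∈ F: (N(a^2)/(1 − N(a))^2) · h_2(f(c)) = c. -/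
open Finset in
/-- The square of a sum, with each pair of indices listed once. -/
theorem sum_Icc_mul_ite_eq_sq {R : Type*} [CommRing R] (k : ℕ) (w : ℕ → R) :
    ∑ i ∈ Icc 1 k, ∑ j ∈ Icc i k, (if i = j then (1 : R) else 2) * (w i * w j) =
      (∑ i ∈ Icc 1 k, w i) ^ 2 := by
  induction k with
  | zero => simp
  | succ k ih =>
    rw [sum_Icc_succ_top (by omega), Icc_self, sum_singleton, sum_Icc_succ_top (by omega),
      add_sq, ← ih, if_pos rfl, mul_sum, sum_mul]
    have h : ∀ i ∈ Icc 1 k, ∑ j ∈ Icc i (k + 1), (if i = j then (1 : R) else 2) * (w i * w j) =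
        (∑ j ∈ Icc i k, (if i = j then (1 : R) else 2) * (w i * w j)) +
          2 * w i * w (k + 1) := by
      intro i hi
      rw [mem_Icc] at hi
      rw [sum_Icc_succ_top (by omega), if_neg (by omega), mul_assoc]
    rw [sum_congr rfl h, sum_add_distrib]
    ring

/-- Iterating the relation `y ^ Q = z + a * y`, where `Q` is a power of the characteristic. -/
theorem pow_pow_eq_of_pow_eq_add {K : Type*} [Field K] (p e : ℕ) [ExpChar K p] {Q : ℕ}
    (hQ : Q = p ^ e) {a y z : K} (ha : a ≠ 0) (h : y ^ Q = z + a * y) (t : ℕ) :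
    y ^ Q ^ t = a ^ (∑ l ∈ Finset.range t, Q ^ l) *
      (y + ∑ i ∈ Finset.Icc 1 t, a⁻¹ ^ (∑ l ∈ Finset.range i, Q ^ l) * z ^ Q ^ (i - 1)) := by
  induction t with
  | zero => simp
  | succ t ih =>
    have hadd : (z + a * y) ^ Q ^ t = z ^ Q ^ t + (a * y) ^ Q ^ t := by
      rw [hQ, ← pow_mul, add_pow_expChar_pow]
    rw [pow_succ', pow_mul, h, hadd, mul_pow, ih, Finset.sum_Icc_succ_top (by omega), ← add_assoc,
      mul_add _ (_ + _), ← mul_assoc _ (a⁻¹ ^ _), ← mul_pow, mul_inv_cancel₀ ha, one_pow, one_mul,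
      Finset.sum_range_succ, pow_add, Nat.add_sub_cancel]
    ring

/-- The exponent of the norm may be computed with any generator `x ↦ x ^ r ^ m` of the group of
powers of `x ↦ x ^ r`. -/
theorem pow_geom_sum_eq_of_coprime {M : Type*} [CommMonoid M] {r k m : ℕ} (hk : k ≠ 0)
    (hmk : m.Coprime k) {a : M} (ha : a ^ r ^ k = a) :
    a ^ (∑ l ∈ Finset.range k, (r ^ m) ^ l) = a ^ (∑ l ∈ Finset.range k, r ^ l) := by
  have hiter (s : ℕ) : a ^ (r ^ k) ^ s = a := by
    induction s with
    | zero => simp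
    | succ s ih => rw [pow_succ, pow_mul, ih, ha]
  have hmod (j : ℕ) : a ^ r ^ j = a ^ r ^ (j % k) := by
    conv_lhs => rw [← Nat.div_add_mod j k, pow_add, pow_mul, pow_mul, hiter]
  rw [← Finset.prod_pow_eq_pow_sum, ← Finset.prod_pow_eq_pow_sum]
  have hmaps : Set.MapsTo (fun l => m * l % k) (Finset.range k) (Finset.range k) := by
    intro l _
    simpa using Nat.mod_lt _ (Nat.pos_of_ne_zero hk)
  have hinj : Set.InjOn (fun l => m * l % k) (Finset.range k) := by
    intro i hi j hj hij
    simp only [Finset.coe_range, Set.mem_Iio] at hi hj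
    have hij' : i ≡ j [MOD k] :=
      Nat.ModEq.cancel_left_of_coprime (by simpa [Nat.Coprime] using hmk.symm) hij
    exact hij'.eq_of_lt_of_lt hi hj
  refine Finset.prod_nbij (fun l => m * l % k) hmaps hinj
    (Finset.surjOn_of_injOn_of_card_le _ hmaps hinj le_rfl) fun l _ => ?_
  rw [← pow_mul, hmod]

/-- In a finite field of size `u * v + 1`, where `u = gcd e (u * v)`, each root of `X ^ v - 1` is an
`e`-th power. -/
theorem exists_pow_eq_of_pow_eq_one {F : Type*} [Field F] [Fintype F] {e u v : ℕ}
    (hcard : Fintype.card F - 1 = u * v) (he : e.gcd (Fintype.card F - 1) = u)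
    {a : F} (ha : a ≠ 0) (hav : a ^ v = 1) : ∃ c : F, c ≠ 0 ∧ c ^ e = a := by
  classical
  obtain ⟨g, hg⟩ := IsCyclic.exists_monoid_generator (α := Fˣ)
  have hord : orderOf g = Fintype.card F - 1 := by
    rw [orderOf_eq_card_of_forall_mem_powers hg, Nat.card_eq_fintype_card, Fintype.card_units]
  obtain ⟨t, ht⟩ := hg (Units.mk0 a ha)
  replace ht : g ^ t = Units.mk0 a ha := ht
  have hv : 0 < v := by
    have := Fintype.one_lt_card (α := F)
    exact Nat.pos_of_ne_zero fun h => by simp [h] at hcard; omega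
  have hut : u ∣ t := by
    have : g ^ (t * v) = 1 := by
      rw [pow_mul, ht]
      ext
      simpa using hav
    rw [← orderOf_dvd_iff_pow_eq_one, hord, hcard] at this
    exact Nat.dvd_of_mul_dvd_mul_right hv this
  obtain ⟨s, rfl⟩ := hut
  refine ⟨((g ^ (e.gcdA (Fintype.card F - 1))) ^ s : Fˣ), Units.ne_zero _, ?_⟩
  have hgu : g ^ u = (g ^ (e.gcdA (Fintype.card F - 1))) ^ e := by
    have hb := Nat.gcd_eq_gcd_ab e (Fintype.card F - 1)
    rw [he, ← hord] at hb
    rw [← zpow_natCast g u, hb, zpow_add, zpow_mul g (orderOf g : ℤ), zpow_natCast g (orderOf g),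
      pow_orderOf_eq_one, one_zpow, mul_one, mul_comm, zpow_mul, zpow_natCast, hord]
  have : ((g ^ (e.gcdA (Fintype.card F - 1))) ^ s) ^ e = Units.mk0 a ha := by
    rw [← ht, pow_mul, hgu, ← pow_mul, ← pow_mul, mul_comm]
  rw [← Units.val_pow_eq_pow_val, this, Units.val_mk0]

/-- A square root of an element of a finite field of odd size `r` is fixed by
`y ↦ y ^ r ^ (2 * s)`. -/
theorem pow_card_pow_eq_of_sq_eq {F K : Type*} [Field F] [Fintype F] [Field K] [Algebra F K]
    (hodd : Odd (Fintype.card F)) {c : F} {y : K} (hy : y ^ 2 = algebraMap F K c) (s : ℕ) :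
    y ^ Fintype.card F ^ (2 * s) = y := by
  have h2 : y ^ Fintype.card F ^ 2 = y := by
    by_cases hc : c = 0
    · have : y = 0 := by simpa [hc] using hy
      simp [this]
    · obtain ⟨k, hk⟩ := hodd
      have h1 : (y ^ 2) ^ (Fintype.card F - 1) = 1 := by
        rw [hy, ← map_pow, FiniteField.pow_card_sub_one_eq_one c hc, map_one]
      have he : Fintype.card F ^ 2 = 2 * (Fintype.card F - 1) * (k + 1) + 1 := by
        rw [hk, Nat.add_sub_cancel]; ring
      rw [he, pow_succ, pow_mul, pow_mul, h1, one_pow, one_mul]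
  induction s with
  | zero => simp
  | succ s ih => rw [mul_add_one, pow_add, pow_mul, ih, h2]


/-- For `q` odd, `m/d` even: `f(x) = x^{q^m} - 2a x^{(q^m+1)/2} + a^2 x`
permutes `F = 𝔽_{q^n}` iff `N(a) ≠ 1`, and in that case its inverse is
`(N(a^2)/(1 - N(a))^2) h₂(x)`. -/
theorem stmt_9 (q n m : ℕ) (hq : IsPrimePow q) (hq2 : Odd q) (hn : 2 ≤ n)
    (hm1 : 1 ≤ m) (hm2 : m ≤ n - 1)
    (d : ℕ) (hd : d = Nat.gcd m n) (hmd : Even (m / d))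
    (F : Type*) [Field F] [Fintype F] (hF : Fintype.card F = q ^ n)
    (a : F) (ha : a ≠ 0)
    (N : F → F) (hN : ∀ x, N x = x ^ ((q ^ n - 1) / (q ^ d - 1)))
    (f : F → F)
    (hf : ∀ c, f c = c ^ (q ^ m) - 2 * a * c ^ ((q ^ m + 1) / 2) + a ^ 2 * c)
    (h₂ : F → F)
    (hh₂ : ∀ x, h₂ x = ∑ i ∈ Finset.Icc 1 (n / d), ∑ j ∈ Finset.Icc i (n / d),
      (a⁻¹) ^ ((q ^ (i * m) + q ^ (j * m) - 2) / (q ^ m - 1)) *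
        (if i = j then (1 : F) else 2) *
          x ^ ((q ^ ((i - 1) * m) + q ^ ((j - 1) * m)) / 2)) :
    (Function.Bijective f ↔ N a ≠ 1) ∧
      (N a ≠ 1 → ∀ c : F,
        (N (a ^ 2) / (1 - N a) ^ 2) * h₂ (f c) = c) := by
  have hd0 : 0 < d := hd ▸ Nat.gcd_pos_of_pos_left n hm1
  obtain ⟨m', rfl⟩ : d ∣ m := hd ▸ Nat.gcd_dvd_left m n
  obtain ⟨k, rfl⟩ : d ∣ n := hd ▸ Nat.gcd_dvd_right (d * m') n
  rw [Nat.mul_div_cancel_left _ hd0] at hmd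
  simp only [Nat.mul_div_cancel_left _ hd0] at hh₂
  have hcop : m'.Coprime k := by
    rw [Nat.gcd_mul_left] at hd
    exact Nat.eq_of_mul_eq_mul_left hd0 (by rw [← hd, mul_one])
  have hk0 : k ≠ 0 := by rintro rfl; simp at hn
  have hm0 : d * m' ≠ 0 := by omega
  have hq1 : 1 < q := hq.one_lt
  have hone {j : ℕ} (hj : j ≠ 0) : 1 < q ^ j := Nat.one_lt_pow hj hq1
  have hQ1 := hone hm0
  have hr1 := hone hd0.ne'
  have hQodd : Odd (q ^ (d * m')) := hq2.pow
  have hgeom (Q i : ℕ) (hQ : 1 < Q) :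
      (∑ l ∈ Finset.range i, Q ^ l) * (Q - 1) = Q ^ i - 1 := by
    rw [Nat.geomSum_eq hQ, Nat.div_mul_cancel (Nat.sub_one_dvd_pow_sub_one Q i)]
  have hNexp : (q ^ (d * k) - 1) / (q ^ d - 1) = ∑ l ∈ Finset.range k, (q ^ d) ^ l := by
    rw [Nat.geomSum_eq hr1, pow_mul]
  have hNa : N a = a ^ ∑ l ∈ Finset.range k, (q ^ (d * m')) ^ l := by
    rw [hN, hNexp, pow_mul q d m', pow_geom_sum_eq_of_coprime hk0 hcop]
    rw [← pow_mul, ← hF, FiniteField.pow_card]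
  obtain ⟨p, e, hp, he, rfl⟩ := (isPrimePow_nat_iff q).1 hq
  have : Fact p.Prime := ⟨hp⟩
  have : CharP F p := charP_of_card_eq_prime_pow (f := e * (d * k)) (by rw [hF, ← pow_mul])
  set q := p ^ e
  set K := AlgebraicClosure F
  have : CharP K p := charP_of_injective_algebraMap (algebraMap F K).injective p
  have key (c : F) : (1 - N a) ^ 2 * c = N a ^ 2 * h₂ (f c) := by
    obtain ⟨y, hy⟩ := IsAlgClosed.exists_pow_nat_eq (algebraMap F K c) two_pos
    obtain ⟨s, hs⟩ := hmd
    set Q := q ^ (d * m') with hQ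
    set G : ℕ → ℕ := fun i => ∑ l ∈ Finset.range i, Q ^ l
    set α := algebraMap F K a with hα
    have hα0 : α ≠ 0 := by simpa [hα] using ha
    set z := y ^ Q - α * y with hz
    have hyk : y ^ Q ^ k = y := by
      have : Q ^ k = Fintype.card F ^ (2 * s) := by
        rw [hF, hQ, hs, ← pow_mul, ← pow_mul]; ring
      rw [this]
      exact pow_card_pow_eq_of_sq_eq (hF ▸ hq2.pow) hy s
    have hiter := pow_pow_eq_of_pow_eq_add p (e * (d * m')) (Q := Q) (by rw [pow_mul, hQ]) hα0
      (show y ^ Q = z + α * y by rw [hz]; ring) k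
    rw [hyk] at hiter
    have hzf : z ^ 2 = algebraMap F K (f c) := by
      obtain ⟨t, ht⟩ := hQodd
      have h1 : (Q + 1) / 2 = t + 1 := by omega
      rw [hf, h1, hz]
      simp only [map_add, map_sub, map_mul, map_pow, ← hy, map_ofNat, ← hα, ht]
      ring
    have hS : (∑ i ∈ Finset.Icc 1 k, α⁻¹ ^ G i * z ^ Q ^ (i - 1)) ^ 2 =
        algebraMap F K (h₂ (f c)) := by
      rw [← sum_Icc_mul_ite_eq_sq, hh₂, map_sum]
      refine Finset.sum_congr rfl fun i _ => ?_
      rw [map_sum]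
      refine Finset.sum_congr rfl fun j _ => ?_
      have hexp : (q ^ (i * (d * m')) + q ^ (j * (d * m')) - 2) / (Q - 1) = G i + G j := by
        refine Nat.div_eq_of_eq_mul_left (by omega) ?_
        rw [add_mul, hgeom Q i hQ1, hgeom Q j hQ1, mul_comm i, mul_comm j, pow_mul q _ i,
          pow_mul q _ j, ← hQ]
        have := Nat.one_le_pow i Q (by omega)
        have := Nat.one_le_pow j Q (by omega)
        omega
      have hzexp : algebraMap F K (f c) ^
          ((q ^ ((i - 1) * (d * m')) + q ^ ((j - 1) * (d * m'))) / 2) =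
          z ^ (Q ^ (i - 1) + Q ^ (j - 1)) := by
        have heven : Even (Q ^ (i - 1) + Q ^ (j - 1)) := (hQodd.pow).add_odd hQodd.pow
        rw [← hzf, ← pow_mul, mul_comm (i - 1), mul_comm (j - 1), pow_mul q _ (i - 1),
          pow_mul q _ (j - 1), ← hQ, Nat.mul_div_cancel' heven.two_dvd]
      rw [hexp, map_mul, map_mul, map_pow, map_pow, hzexp, map_inv₀, apply_ite (algebraMap F K),
        map_one, map_ofNat]
      ring
    apply (algebraMap F K).injective
    have hNα : algebraMap F K (N a) = α ^ G k := by rw [hNa, map_pow]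
    rw [map_mul, map_mul, map_pow, map_pow, ← hS, ← hy, map_sub, map_one, hNα, ← mul_pow,
      ← mul_pow]
    congr 1
    linear_combination hiter
  have hinv (h : N a ≠ 1) (c : F) : N (a ^ 2) / (1 - N a) ^ 2 * h₂ (f c) = c := by
    have hN2 : N (a ^ 2) = N a ^ 2 := by rw [hN, hN, pow_right_comm]
    have : (1 - N a) ^ 2 ≠ 0 := pow_ne_zero 2 (sub_ne_zero.2 h.symm)
    rw [hN2, div_mul_eq_mul_div, ← key, mul_div_cancel_left₀ _ this]
  refine ⟨⟨fun hbij h => ?_, fun h => ?_⟩, hinv⟩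
  · obtain ⟨s, hs⟩ := hmd
    have hdvd : q ^ d - 1 ∣ (q ^ (d * m') - 1) / 2 := by
      have hsplit : q ^ (d * m') - 1 = (q ^ (d * s) - 1) * (q ^ (d * s) + 1) := by
        rw [hs, mul_add, ← two_mul, mul_comm 2, pow_mul, mul_comm (_ - 1), ← Nat.sq_sub_sq,
          one_pow]
      have heven : 2 ∣ q ^ (d * s) + 1 := (hq2.pow.add_odd odd_one).two_dvd
      rw [hsplit, Nat.mul_div_assoc _ heven, pow_mul]
      exact (Nat.sub_one_dvd_pow_sub_one _ s).mul_right _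
    have hgcd : ((q ^ (d * m') - 1) / 2).gcd (Fintype.card F - 1) = q ^ d - 1 := by
      refine Nat.dvd_antisymm ?_ (Nat.dvd_gcd hdvd ?_)
      · have h2 : 2 ∣ q ^ (d * m') - 1 := (Nat.Odd.sub_odd hQodd odd_one).two_dvd
        have := Nat.gcd_dvd_gcd_of_dvd_left (Fintype.card F - 1) (Nat.div_dvd_of_dvd h2)
        rwa [hF, Nat.pow_sub_one_gcd_pow_sub_one, ← hd, ← hF] at this
      · rw [hF, pow_mul]
        exact Nat.sub_one_dvd_pow_sub_one _ k
    obtain ⟨c, hc0, hc⟩ := exists_pow_eq_of_pow_eq_one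
      (v := ∑ l ∈ Finset.range k, (q ^ d) ^ l)
      (by rw [hF, mul_comm (q ^ d - 1), hgeom _ _ hr1, pow_mul]) hgcd ha (by rw [← hNexp, ← hN, h])
    refine hc0 (hbij.injective ?_)
    obtain ⟨t, ht⟩ := hQodd
    rw [ht] at hc hf
    have h1 : (2 * t + 1 - 1) / 2 = t := by omega
    have h2 : (2 * t + 1 + 1) / 2 = t + 1 := by omega
    rw [h1] at hc
    rw [hf, hf, h2, ← hc]
    ring
  · exact Finite.injective_iff_bijective.1 (Function.LeftInverse.injective
      (g := fun x => N (a ^ 2) / (1 - N a) ^ 2 * h₂ x) (hinv h))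
end

section
/- Let n be a positive integer, F a finite field with 5^n elements, and a ∈ F, a ≠ 0. Then the map f(c) = c^5 − 2a·c^3 + a^2·c is a bijection of F if and only if a^{(5^n − 1)/2} = −1. In that case, defining b_{ij} = 1 if i = j and b_{ij} = 2 if i < j, one has for every c ∈ F: 2·a^{(5^n − 1)/4} · (f(c))^{(5^n − 1)/2} · Σ_{1 ≤ i ≤ j ≤ n} a^{−(5^i + 5^j − 2)/4} · b_{ij} · (f(c))^{(5^{i−1} + 5^{j−1})/2} = c. -/
/-- Summing a symmetric product over ordered pairs, off-diagonal pairs counted twice,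
gives the square of the sum. -/
lemma sum_Icc_triangle_mul_eq_sq {R : Type*} [CommRing R] (g : ℕ → R) (n : ℕ) :
    ∑ i ∈ Finset.Icc 1 n, ∑ j ∈ Finset.Icc i n, g i * g j * (if i = j then (1 : R) else 2) =
      (∑ i ∈ Finset.Icc 1 n, g i) ^ 2 := by
  induction n with
  | zero => simp
  | succ n ih =>
    have h : ∀ i ∈ Finset.Icc 1 n,
        ∑ j ∈ Finset.Icc i (n + 1), g i * g j * (if i = j then (1 : R) else 2) =
          ∑ j ∈ Finset.Icc i n, g i * g j * (if i = j then (1 : R) else 2) +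
            g i * (g (n + 1) * 2) := by
      intro i hi
      have hi' := (Finset.mem_Icc.1 hi).2
      rw [Finset.sum_Icc_succ_top (by lia), if_neg (by lia), mul_assoc]
    rw [Finset.sum_Icc_succ_top (by lia), Finset.sum_Icc_succ_top (by lia : 1 ≤ n + 1) g,
      Finset.sum_congr rfl h, Finset.sum_add_distrib, ih, ← Finset.sum_mul]
    simp
    ring

lemma four_mul_five_pow_sub_one_div_four (k : ℕ) : 4 * ((5 ^ k - 1) / 4) + 1 = 5 ^ k := by
  have h : 4 ∣ 5 ^ k - 1 := by simpa using Nat.sub_dvd_pow_sub_pow 5 1 k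
  have := Nat.one_le_pow k 5 (by norm_num)
  lia

/-- The quadratic form in the inverse of `x ^ 5 - 2 a x ^ 3 + a ^ 2 x` is, up to a linear factor,
the square of a telescoping sum. -/
lemma sum_Icc_inv_pow_mul_pow_eq {F : Type*} [Field F] (a y : F) (n : ℕ) :
    ∑ i ∈ Finset.Icc 1 n, ∑ j ∈ Finset.Icc i n,
        (a⁻¹) ^ ((5 ^ i + 5 ^ j - 2) / 4) * (if i = j then (1 : F) else 2) *
          y ^ ((5 ^ (i - 1) + 5 ^ (j - 1)) / 2) =
      y * (∑ i ∈ Finset.Icc 1 n,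
        (a⁻¹) ^ ((5 ^ i - 1) / 4) * y ^ (2 * ((5 ^ (i - 1) - 1) / 4))) ^ 2 := by
  rw [← sum_Icc_triangle_mul_eq_sq, Finset.mul_sum]
  refine Finset.sum_congr rfl fun i _ => ?_
  rw [Finset.mul_sum]
  refine Finset.sum_congr rfl fun j _ => ?_
  have h₁ : (5 ^ i + 5 ^ j - 2) / 4 = (5 ^ i - 1) / 4 + (5 ^ j - 1) / 4 := by
    have := four_mul_five_pow_sub_one_div_four i
    have := four_mul_five_pow_sub_one_div_four j
    lia
  have h₂ : (5 ^ (i - 1) + 5 ^ (j - 1)) / 2 =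
      2 * ((5 ^ (i - 1) - 1) / 4) + 2 * ((5 ^ (j - 1) - 1) / 4) + 1 := by
    have := four_mul_five_pow_sub_one_div_four (i - 1)
    have := four_mul_five_pow_sub_one_div_four (j - 1)
    lia
  rw [h₁, h₂, pow_add, pow_succ, pow_add]
  ring

lemma sub_mul_sum_Icc_inv_pow_mul_pow {F : Type*} [Field F] [CharP F 5] {a : F} (ha : a ≠ 0)
    (c : F) (n : ℕ) :
    (c ^ 2 - a) * ∑ i ∈ Finset.Icc 1 n, (a⁻¹) ^ ((5 ^ i - 1) / 4) *
        (c * (c ^ 2 - a) ^ 2) ^ (2 * ((5 ^ (i - 1) - 1) / 4)) =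
      (a⁻¹ * c ^ 2) ^ ((5 ^ n - 1) / 4) - 1 := by
  have : Fact (Nat.Prime 5) := ⟨by norm_num⟩
  induction n with
  | zero => simp
  | succ k ih =>
    rw [Finset.sum_Icc_succ_top (by lia), mul_add, ih, Nat.add_sub_cancel]
    have hk := four_mul_five_pow_sub_one_div_four k
    have he : (5 ^ (k + 1) - 1) / 4 = (5 ^ k - 1) / 4 + 5 ^ k := by
      rw [pow_succ]; lia
    have hfrob : (c ^ 2 - a) ^ (4 * ((5 ^ k - 1) / 4) + 1) =
        (c ^ 2) ^ 5 ^ k - a ^ 5 ^ k := by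
      rw [hk, sub_pow_char_pow]
    have hterm : (c ^ 2 - a) * (c * (c ^ 2 - a) ^ 2) ^ (2 * ((5 ^ k - 1) / 4)) =
        (c ^ 2) ^ ((5 ^ k - 1) / 4) * ((c ^ 2) ^ 5 ^ k - a ^ 5 ^ k) := by
      rw [← hfrob, mul_pow, ← pow_mul, ← pow_mul]
      ring
    have hinv : (a⁻¹) ^ 5 ^ k * a ^ 5 ^ k = 1 := by
      rw [← mul_pow, inv_mul_cancel₀ ha, one_pow]
    rw [mul_left_comm, hterm, he, mul_pow, mul_pow, pow_add, pow_add]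
    linear_combination (-(a⁻¹) ^ ((5 ^ k - 1) / 4) * (c ^ 2) ^ ((5 ^ k - 1) / 4)) * hinv

/-- `f(x) = x^5 - 2a x^3 + a^2 x` permutes `F = 𝔽_{5^n}` iff
`a^{(5^n-1)/2} = -1`, and in that case its explicit inverse is given. -/
theorem stmt_11 (n : ℕ) (hn : 0 < n)
    (F : Type*) [Field F] [Fintype F] (hF : Fintype.card F = 5 ^ n)
    (a : F) (ha : a ≠ 0)
    (f : F → F) (hf : ∀ c, f c = c ^ 5 - 2 * a * c ^ 3 + a ^ 2 * c) :
    (Function.Bijective f ↔ a ^ ((5 ^ n - 1) / 2) = -1) ∧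
      (a ^ ((5 ^ n - 1) / 2) = -1 → ∀ c : F,
        2 * a ^ ((5 ^ n - 1) / 4) * (f c) ^ ((5 ^ n - 1) / 2) *
          ∑ i ∈ Finset.Icc 1 n, ∑ j ∈ Finset.Icc i n,
            (a⁻¹) ^ ((5 ^ i + 5 ^ j - 2) / 4) *
              (if i = j then (1 : F) else 2) *
                (f c) ^ ((5 ^ (i - 1) + 5 ^ (j - 1)) / 2) = c) := by
  have : Fact (Nat.Prime 5) := ⟨by norm_num⟩
  have : CharP F 5 := charP_of_card_eq_prime_pow hF
  have h5 : (5 : F) = 0 := by exact_mod_cast CharP.cast_eq_zero F 5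
  have hn4 := four_mul_five_pow_sub_one_div_four n
  have hpos : 1 < 5 ^ n := Nat.one_lt_pow hn.ne' (by norm_num)
  have hhalf : (5 ^ n - 1) / 2 = 2 * ((5 ^ n - 1) / 4) := by lia
  have hf' : ∀ c, f c = c * (c ^ 2 - a) ^ 2 := fun c => by rw [hf]; ring
  have hsq : ∀ x : F, x ≠ 0 → (x ^ ((5 ^ n - 1) / 2)) ^ 2 = 1 := fun x hx => by
    rw [← pow_mul, show (5 ^ n - 1) / 2 * 2 = Fintype.card F - 1 by rw [hF]; lia]
    exact FiniteField.pow_card_sub_one_eq_one x hx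
  have hsquare : ∀ x : F, x ≠ 0 → IsSquare x → x ^ ((5 ^ n - 1) / 2) = 1 := by
    rintro _ hx ⟨b, rfl⟩
    rw [mul_pow, ← sq]
    exact hsq b (left_ne_zero_of_mul hx)
  have hinverse : a ^ ((5 ^ n - 1) / 2) = -1 → ∀ c : F,
        2 * a ^ ((5 ^ n - 1) / 4) * (f c) ^ ((5 ^ n - 1) / 2) *
          ∑ i ∈ Finset.Icc 1 n, ∑ j ∈ Finset.Icc i n,
            (a⁻¹) ^ ((5 ^ i + 5 ^ j - 2) / 4) *
              (if i = j then (1 : F) else 2) *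
                (f c) ^ ((5 ^ (i - 1) + 5 ^ (j - 1)) / 2) = c := by
    intro hneg c
    rcases eq_or_ne c 0 with rfl | hc
    · have h0 : f 0 = 0 := by simp [hf]
      rw [h0, zero_pow (by lia)]
      simp
    have hne : c ^ 2 - a ≠ 0 := fun h => by
      have h1 := hsquare a ha ⟨c, by rw [← sq]; exact (sub_eq_zero.1 h).symm⟩
      have h2 : (2 : F) = 0 := by linear_combination h1.symm.trans hneg
      exact one_ne_zero (by linear_combination h5 - 2 * h2 : (1 : F) = 0)
    have htel := sub_mul_sum_Icc_inv_pow_mul_pow ha c n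
    rw [sum_Icc_inv_pow_mul_pow_eq, hf']
    set T := ∑ i ∈ Finset.Icc 1 n, (a⁻¹) ^ ((5 ^ i - 1) / 4) *
        (c * (c ^ 2 - a) ^ 2) ^ (2 * ((5 ^ (i - 1) - 1) / 4))
    have hη := hsq c hc
    have hy : (c * (c ^ 2 - a) ^ 2) ^ ((5 ^ n - 1) / 2) = c ^ ((5 ^ n - 1) / 2) := by
      rw [mul_pow, pow_right_comm, hsq _ hne, mul_one]
    have hι : (a ^ ((5 ^ n - 1) / 4)) ^ 2 = -1 := by
      rw [← hneg, hhalf, ← pow_mul, mul_comm]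
    have hιinv : (a⁻¹) ^ ((5 ^ n - 1) / 4) = -a ^ ((5 ^ n - 1) / 4) := by
      rw [inv_pow]
      exact inv_eq_of_mul_eq_one_right (by linear_combination -hι)
    rw [mul_pow, hιinv, ← pow_mul, ← hhalf] at htel
    rw [hy]
    set η := c ^ ((5 ^ n - 1) / 2)
    set ι := a ^ ((5 ^ n - 1) / 4)
    have hsqT : ((c ^ 2 - a) * T) ^ 2 = 2 * ι * η := by
      rw [htel]
      linear_combination η ^ 2 * hι - hη
    linear_combination 2 * ι * η * c * hsqT + 4 * c * η ^ 2 * hι - 4 * c * hη - c * h5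
  refine ⟨⟨fun hbij => ?_, fun hneg => ?_⟩, hinverse⟩
  · refine (eq_or_eq_neg_of_sq_eq_sq _ _ ((hsq a ha).trans (one_pow 2).symm)).resolve_left
      fun h1 => ?_
    have hchar : ringChar F ≠ 2 := by rw [ringChar.eq F 5]; norm_num
    obtain ⟨b, rfl⟩ := (FiniteField.isSquare_iff hchar ha).2 (by
      rwa [hF, show 5 ^ n / 2 = (5 ^ n - 1) / 2 by lia])
    refine left_ne_zero_of_mul ha (hbij.injective ?_)
    rw [hf', hf']
    ring
  · refine Finite.injective_iff_bijective.1 fun x y hxy => ?_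
    rw [← hinverse hneg x, ← hinverse hneg y, hxy]
end

section
/- Let n be a positive integer, F a finite field with 7^n elements, and a ∈ F, a ≠ 0. Then the map f(c) = c^7 − 2a·c^4 + a^2·c is a bijection of F if and only if a^{(7^n − 1)/3} ≠ 1. In that case, defining b_{ij} = 1 if i = j and b_{ij} = 2 if i < j, one has for every c ∈ F: (4·a^{(7^n − 1)/6} · (f(c))^{(7^n − 1)/2} − 2·a^{−(7^n − 1)/3}) · Σ_{1 ≤ i ≤ j ≤ n} a^{−(7^i + 7^j − 2)/6} · b_{ij} · (f(c))^{(7^{i−1} + 7^{j−1})/2} = c. -/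
/-- The square of a finite sum, arranged over the pairs `i ≤ j`. -/
theorem sum_Icc_sum_Icc_eq_sq {R : Type*} [CommRing R] (g : ℕ → R) (n : ℕ) :
    ∑ i ∈ Finset.Icc 1 n, ∑ j ∈ Finset.Icc i n, (if i = j then (1 : R) else 2) * (g i * g j) =
      (∑ i ∈ Finset.Icc 1 n, g i) ^ 2 := by
  induction n with
  | zero => simp
  | succ n ih =>
    have inner : ∀ i ∈ Finset.Icc 1 n,
        ∑ j ∈ Finset.Icc i (n + 1), (if i = j then (1 : R) else 2) * (g i * g j) =
          ∑ j ∈ Finset.Icc i n, (if i = j then (1 : R) else 2) * (g i * g j) +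
            g i * (2 * g (n + 1)) := by
      intro i hi
      have hi' := (Finset.mem_Icc.mp hi).2
      rw [Finset.sum_Icc_succ_top (by omega), if_neg (by omega : ¬ i = n + 1)]
      ring
    rw [Finset.sum_Icc_succ_top (by omega), Finset.sum_Icc_succ_top (f := g) (by omega),
      Finset.sum_congr rfl inner, Finset.sum_add_distrib, ih, ← Finset.sum_mul]
    simp only [Finset.Icc_self, Finset.sum_singleton, if_true]
    ring

theorem exists_seven_pow_eq_six_mul_add_one (n : ℕ) : ∃ m, 7 ^ n = 6 * m + 1 := by
  induction n with
  | zero => exact ⟨0, rfl⟩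
  | succ n ih =>
    obtain ⟨m, hm⟩ := ih
    exact ⟨7 * m + 1, by rw [pow_succ]; omega⟩

/-- In characteristic `7`, the sum obtained from a square root `w` of `c` telescopes. -/
theorem sum_Icc_telescope {K : Type*} [Field K] [CharP K 7] {a : K} (ha : a ≠ 0) (w : K) (n : ℕ) :
    ∑ i ∈ Finset.Icc 1 n, a⁻¹ ^ ((7 ^ i - 1) / 6) * (w ^ 7 - a * w) ^ 7 ^ (i - 1) =
      a⁻¹ ^ ((7 ^ n - 1) / 6) * w ^ 7 ^ n - w := by
  have : Fact (Nat.Prime 7) := ⟨by norm_num⟩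
  induction n with
  | zero => simp
  | succ n ih =>
    rw [Finset.sum_Icc_succ_top (by omega), ih, Nat.add_sub_cancel, sub_pow_char_pow, mul_pow,
      ← pow_mul, ← pow_succ']
    obtain ⟨m, hm⟩ := exists_seven_pow_eq_six_mul_add_one n
    have e₁ : (7 ^ n - 1) / 6 = m := by omega
    have e₂ : (7 ^ (n + 1) - 1) / 6 = m + 7 ^ n := by rw [pow_succ]; omega
    have hcancel : a⁻¹ ^ 7 ^ n * a ^ 7 ^ n = 1 := by
      rw [← mul_pow, inv_mul_cancel₀ ha, one_pow]
    rw [e₁, e₂, pow_add]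
    linear_combination (-(a⁻¹ ^ m * w ^ 7 ^ n)) * hcancel

/-- The double sum of the inverse formula, evaluated through a square root `w`. -/
theorem sum_sum_eq_sq_of_sqrt {K : Type*} [Field K] [CharP K 7] {a : K} (ha : a ≠ 0) (w : K)
    (n : ℕ) :
    ∑ i ∈ Finset.Icc 1 n, ∑ j ∈ Finset.Icc i n,
        a⁻¹ ^ ((7 ^ i + 7 ^ j - 2) / 6) * (if i = j then (1 : K) else 2) *
          ((w ^ 7 - a * w) ^ 2) ^ ((7 ^ (i - 1) + 7 ^ (j - 1)) / 2) =
      (a⁻¹ ^ ((7 ^ n - 1) / 6) * w ^ 7 ^ n - w) ^ 2 := by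
  rw [← sum_Icc_telescope ha w n, ← sum_Icc_sum_Icc_eq_sq]
  refine Finset.sum_congr rfl fun i _ => Finset.sum_congr rfl fun j _ => ?_
  obtain ⟨k, hk⟩ := exists_seven_pow_eq_six_mul_add_one i
  obtain ⟨l, hl⟩ := exists_seven_pow_eq_six_mul_add_one j
  obtain ⟨k', hk'⟩ := exists_seven_pow_eq_six_mul_add_one (i - 1)
  obtain ⟨l', hl'⟩ := exists_seven_pow_eq_six_mul_add_one (j - 1)
  have e₁ : (7 ^ i + 7 ^ j - 2) / 6 = (7 ^ i - 1) / 6 + (7 ^ j - 1) / 6 := by omega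
  have e₂ : 2 * ((7 ^ (i - 1) + 7 ^ (j - 1)) / 2) = 7 ^ (i - 1) + 7 ^ (j - 1) := by omega
  rw [e₁, ← pow_mul, e₂, pow_add, pow_add]
  ring

/-- The converse half of Euler's criterion for `d`-th powers in a finite field of order `d m + 1`. -/
theorem FiniteField.exists_pow_eq_of_pow_eq_one {F : Type*} [Field F] [Fintype F]
    {d m : ℕ} (hm : 0 < m) (hcard : Fintype.card F = d * m + 1) {a : F} (ha : a ≠ 0)
    (h : a ^ m = 1) : ∃ b : F, b ^ d = a := by
  classical
  obtain ⟨g, hg⟩ := IsCyclic.exists_generator (α := Fˣ)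
  obtain ⟨k, hk⟩ := (Submonoid.mem_powers_iff _ _).mp
    (mem_powers_iff_mem_zpowers.mpr (hg (Units.mk0 a ha)))
  have hord : orderOf g = d * m := by
    rw [orderOf_eq_card_of_forall_mem_zpowers hg, Nat.card_eq_fintype_card, Fintype.card_units,
      hcard, Nat.add_sub_cancel]
  have hone : g ^ (k * m) = 1 := by
    rw [pow_mul, hk]
    ext
    simpa using h
  obtain ⟨r, hr⟩ : d ∣ k :=
    Nat.dvd_of_mul_dvd_mul_right hm (hord ▸ orderOf_dvd_of_pow_eq_one hone)
  refine ⟨((g ^ r : Fˣ) : F), ?_⟩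
  rw [← Units.val_pow_eq_pow_val, ← pow_mul, mul_comm, ← hr, hk, Units.val_mk0]

/-- The inverse formula for `x ^ 7 - 2 a x ^ 4 + a ^ 2 x` when `a` is not a cube. -/
theorem inverse_formula {n : ℕ} {F : Type*} [Field F] [Fintype F]
    (hF : Fintype.card F = 7 ^ n) [CharP F 7] {a : F} (ha : a ≠ 0)
    (h3 : a ^ ((7 ^ n - 1) / 3) ≠ 1) (c : F) :
    (4 * a ^ ((7 ^ n - 1) / 6) * (c ^ 7 - 2 * a * c ^ 4 + a ^ 2 * c) ^ ((7 ^ n - 1) / 2) -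
        2 * a⁻¹ ^ ((7 ^ n - 1) / 3)) *
      ∑ i ∈ Finset.Icc 1 n, ∑ j ∈ Finset.Icc i n,
        a⁻¹ ^ ((7 ^ i + 7 ^ j - 2) / 6) * (if i = j then (1 : F) else 2) *
          (c ^ 7 - 2 * a * c ^ 4 + a ^ 2 * c) ^ ((7 ^ (i - 1) + 7 ^ (j - 1)) / 2) = c := by
  obtain ⟨m, hm⟩ := exists_seven_pow_eq_six_mul_add_one n
  have e₆ : (7 ^ n - 1) / 6 = m := by omega
  have e₃ : (7 ^ n - 1) / 3 = m * 2 := by omega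
  have e₂ : (7 ^ n - 1) / 2 = 3 * m := by omega
  have fermat : ∀ x : F, x ≠ 0 → x ^ (6 * m) = 1 := fun x hx => by
    rw [← FiniteField.pow_card_sub_one_eq_one x hx, hF, hm, Nat.add_sub_cancel]
  have hsum : ∑ i ∈ Finset.Icc 1 n, ∑ j ∈ Finset.Icc i n,
        a⁻¹ ^ ((7 ^ i + 7 ^ j - 2) / 6) * (if i = j then (1 : F) else 2) *
          (c ^ 7 - 2 * a * c ^ 4 + a ^ 2 * c) ^ ((7 ^ (i - 1) + 7 ^ (j - 1)) / 2) =
      c * (a⁻¹ ^ m * c ^ (3 * m) - 1) ^ 2 := by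
    let φ := algebraMap F (AlgebraicClosure F)
    have : CharP (AlgebraicClosure F) 7 := charP_of_injective_algebraMap φ.injective 7
    obtain ⟨w, hw⟩ := IsAlgClosed.exists_pow_nat_eq (φ c) (n := 2) (by norm_num)
    apply φ.injective
    have key := sum_sum_eq_sq_of_sqrt ((map_ne_zero φ).mpr ha) w n
    have hfc : (w ^ 7 - φ a * w) ^ 2 =
        φ c ^ 7 - 2 * φ a * φ c ^ 4 + φ a ^ 2 * φ c := by rw [← hw]; ring
    have hwq : w ^ 7 ^ n = w * φ c ^ (3 * m) := by
      rw [hm, ← hw, ← pow_mul]; ring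
    rw [hfc, hwq, e₆] at key
    simp only [map_sum, map_mul, map_pow, map_inv₀, map_sub, map_add, map_ofNat, map_one,
      apply_ite φ]
    rw [key, ← hw]
    ring
  rw [hsum, e₆, e₃, e₂, pow_mul a⁻¹]
  rw [e₃, pow_mul] at h3
  rcases eq_or_ne c 0 with rfl | hc
  · ring
  have hca : c ^ 3 - a ≠ 0 := fun h => h3 <| by
    rw [← sub_eq_zero.mp h, ← pow_mul, ← pow_mul, ← fermat c hc]
    ring
  have hfac : (c ^ 7 - 2 * a * c ^ 4 + a ^ 2 * c) ^ (3 * m) = c ^ (3 * m) := by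
    have : c ^ 7 - 2 * a * c ^ 4 + a ^ 2 * c = c * (c ^ 3 - a) ^ 2 := by ring
    rw [this, mul_pow, ← pow_mul, show 2 * (3 * m) = 6 * m by ring, fermat _ hca, mul_one]
  have hε : (c ^ (3 * m)) ^ 2 = 1 := by rw [← pow_mul, ← fermat c hc]; ring
  have hA : (a ^ m) ^ 6 = 1 := by rw [← pow_mul, mul_comm, fermat a ha]
  have hAB : a⁻¹ ^ m * a ^ m = 1 := by rw [← mul_pow, inv_mul_cancel₀ ha, one_pow]
  have h7 : (7 : F) = 0 := by exact_mod_cast CharP.cast_eq_zero F 7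
  rw [hfac]
  generalize c ^ (3 * m) = ε at *
  generalize a⁻¹ ^ m = B at *
  generalize a ^ m = A at *
  have hquad : A ^ 4 + A ^ 2 + 1 = 0 := by
    refine (mul_eq_zero.mp ?_).resolve_left (sub_ne_zero.mpr h3)
    linear_combination hA
  have hB : B = A ^ 5 := by linear_combination A ^ 5 * hAB - B * hA
  have hA' : A ^ 4 = -A ^ 2 - 1 := by linear_combination hquad
  have hB' : B = -A ^ 3 - A := by linear_combination hB + A * hA'
  have hB2 : B ^ 2 = -A ^ 2 - 1 := by
    rw [hB]; linear_combination A ^ 4 * hA + hA'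
  have hAB' : A * B = 1 := by rw [mul_comm, hAB]
  have hsq : (B * ε - 1) ^ 2 = -A ^ 2 - 2 * B * ε := by linear_combination B ^ 2 * hε + hB2
  rw [hsq, hB2]
  linear_combination c * (-8 * ε ^ 2 - 4 * A * ε) * hAB' - 8 * c * hε - 4 * c * ε * hB' -
    2 * c * hquad - c * h7

/-- `f(x) = x^7 - 2a x^4 + a^2 x` permutes `F = 𝔽_{7^n}` iff
`a^{(7^n-1)/3} ≠ 1`, and in that case its explicit inverse is given. -/
theorem stmt_12 (n : ℕ) (hn : 0 < n)
    (F : Type*) [Field F] [Fintype F] (hF : Fintype.card F = 7 ^ n)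
    (a : F) (ha : a ≠ 0)
    (f : F → F) (hf : ∀ c, f c = c ^ 7 - 2 * a * c ^ 4 + a ^ 2 * c) :
    (Function.Bijective f ↔ a ^ ((7 ^ n - 1) / 3) ≠ 1) ∧
      (a ^ ((7 ^ n - 1) / 3) ≠ 1 → ∀ c : F,
        (4 * a ^ ((7 ^ n - 1) / 6) * (f c) ^ ((7 ^ n - 1) / 2) -
            2 * (a⁻¹) ^ ((7 ^ n - 1) / 3)) *
          ∑ i ∈ Finset.Icc 1 n, ∑ j ∈ Finset.Icc i n,
            (a⁻¹) ^ ((7 ^ i + 7 ^ j - 2) / 6) *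
              (if i = j then (1 : F) else 2) *
                (f c) ^ ((7 ^ (i - 1) + 7 ^ (j - 1)) / 2) = c) := by
  have : Fact (Nat.Prime 7) := ⟨by norm_num⟩
  have : CharP F 7 := charP_of_card_eq_prime_pow hF
  have formula : a ^ ((7 ^ n - 1) / 3) ≠ 1 → ∀ c : F,
      (4 * a ^ ((7 ^ n - 1) / 6) * (f c) ^ ((7 ^ n - 1) / 2) -
          2 * (a⁻¹) ^ ((7 ^ n - 1) / 3)) *
        ∑ i ∈ Finset.Icc 1 n, ∑ j ∈ Finset.Icc i n,
          (a⁻¹) ^ ((7 ^ i + 7 ^ j - 2) / 6) *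
            (if i = j then (1 : F) else 2) *
              (f c) ^ ((7 ^ (i - 1) + 7 ^ (j - 1)) / 2) = c := fun h3 c => by
    rw [hf]
    exact inverse_formula hF ha h3 c
  refine ⟨⟨fun hbij h => ?_, fun h3 => Finite.injective_iff_bijective.mp fun x y hxy => ?_⟩, formula⟩
  · obtain ⟨m, hm⟩ := exists_seven_pow_eq_six_mul_add_one n
    have hm0 : 0 < m := by
      have := Nat.one_lt_pow hn.ne' (by norm_num : 1 < 7)
      omega
    rw [show (7 ^ n - 1) / 3 = 2 * m by omega] at h
    obtain ⟨b, rfl⟩ := FiniteField.exists_pow_eq_of_pow_eq_one (d := 3)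
      (by omega) (by omega) ha h
    have hb : b = 0 := hbij.injective (by rw [hf, hf]; ring)
    exact ha (by rw [hb]; ring)
  · rw [← formula h3 x, hxy, formula h3 y]
end

section
/- Let n be a positive integer, F a finite field with 7^n elements, and a ∈ F, a ≠ 0. Then the map f(c) = c^7 − 3a·c^5 + 3a^2·c^3 − a^3·c is a bijection of F if and only if a^{(7^n − 1)/2} = −1. In that case, defining b_{ijk} = 1 if i = j = k, b_{ijk} = 3 if exactly two of i, j, k are equal (i.e. i = j < k or i < j = k), b_{ijk} = 6 if i < j < k, and h_3(x) = Σ_{1 ≤ i ≤ j ≤ k ≤ n} a^{−(7^i + 7^j + 7^k − 3)/6} · b_{ijk} · x^{(7^{i−1} + 7^{j−1} + 7^{k−1})/3}, one has for every c ∈ F: (3·(a·(f(c))^4)^{(7^n − 1)/6} − 3·(a·f(c))^{(7^n − 1)/3} − 2) · h_3(f(c)) = c. -/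
theorem seven_pow_eq (m : ℕ) : 7 ^ m = 6 * ((7 ^ m - 1) / 6) + 1 := by
  induction m with
  | zero => rfl
  | succ k ih => rw [pow_succ]; omega

theorem Finset.sum_Icc_eq_head_add {R : Type*} [AddCommMonoid R] (s : ℕ → R) {m n : ℕ}
    (h : m ≤ n) : ∑ i ∈ Finset.Icc m n, s i = s m + ∑ i ∈ Finset.Icc (m + 1) n, s i := by
  have hI : Finset.Icc m n = insert m (Finset.Icc (m + 1) n) := by
    ext x
    simp only [Finset.mem_Icc, Finset.mem_insert]
    omega
  rw [hI, Finset.sum_insert (by simp)]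

theorem sum_Icc_sq {R : Type*} [CommRing R] (s : ℕ → R) (n m : ℕ) :
    (∑ i ∈ Finset.Icc m n, s i) ^ 2 =
      ∑ i ∈ Finset.Icc m n, ∑ j ∈ Finset.Icc i n, (if i = j then 1 else 2) * (s i * s j) := by
  induction hd : n + 1 - m generalizing m with
  | zero => simp [Finset.Icc_eq_empty_of_lt (show n < m by omega)]
  | succ d ih =>
    have hmn : m ≤ n := by omega
    have hrow : ∑ j ∈ Finset.Icc (m + 1) n, (if m = j then 1 else 2) * (s m * s j) =
        2 * s m * ∑ j ∈ Finset.Icc (m + 1) n, s j := by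
      rw [Finset.mul_sum]
      refine Finset.sum_congr rfl fun j hj => ?_
      rw [Finset.mem_Icc] at hj
      rw [if_neg (by omega)]
      ring
    rw [Finset.sum_Icc_eq_head_add _ hmn, Finset.sum_Icc_eq_head_add _ hmn, ← ih (m + 1) (by omega),
      Finset.sum_Icc_eq_head_add _ hmn, hrow, if_pos rfl]
    ring

theorem sum_Icc_cube {R : Type*} [CommRing R] (s : ℕ → R) (n m : ℕ) :
    (∑ i ∈ Finset.Icc m n, s i) ^ 3 =
      ∑ i ∈ Finset.Icc m n, ∑ j ∈ Finset.Icc i n, ∑ k ∈ Finset.Icc j n,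
        (if i = j ∧ j = k then 1 else if i < j ∧ j < k then 6 else 3) * (s i * s j * s k) := by
  induction hd : n + 1 - m generalizing m with
  | zero => simp [Finset.Icc_eq_empty_of_lt (show n < m by omega)]
  | succ d ih =>
    have hmn : m ≤ n := by omega
    have hrow : ∑ k ∈ Finset.Icc (m + 1) n,
        (if m = m ∧ m = k then 1 else if m < m ∧ m < k then 6 else 3) * (s m * s m * s k) =
        3 * s m ^ 2 * ∑ k ∈ Finset.Icc (m + 1) n, s k := by
      rw [Finset.mul_sum]
      refine Finset.sum_congr rfl fun k hk => ?_
      rw [Finset.mem_Icc] at hk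
      rw [if_neg (by omega), if_neg (by omega)]
      ring
    have hplane : ∑ j ∈ Finset.Icc (m + 1) n, ∑ k ∈ Finset.Icc j n,
        (if m = j ∧ j = k then 1 else if m < j ∧ j < k then 6 else 3) * (s m * s j * s k) =
        3 * s m * (∑ j ∈ Finset.Icc (m + 1) n, s j) ^ 2 := by
      rw [sum_Icc_sq, Finset.mul_sum]
      refine Finset.sum_congr rfl fun j hj => ?_
      rw [Finset.mul_sum]
      refine Finset.sum_congr rfl fun k hk => ?_
      rw [Finset.mem_Icc] at hj hk
      rw [if_neg (by omega)]
      by_cases hjk : j = k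
      · rw [if_neg (by omega), if_pos hjk]
        ring
      · rw [if_pos (by omega), if_neg hjk]
        ring
    rw [Finset.sum_Icc_eq_head_add _ hmn, Finset.sum_Icc_eq_head_add _ hmn, ← ih (m + 1) (by omega),
      Finset.sum_Icc_eq_head_add _ hmn, Finset.sum_Icc_eq_head_add _ hmn, hrow, hplane,
      if_pos ⟨rfl, rfl⟩]
    ring

/-- Iterating `w = A (y² w⁷ - 1)` in characteristic `7`. -/
theorem eq_iterate_of_eq_mul_pow_seven {F : Type*} [Field F] [CharP F 7] {A y w : F}
    (h : w = A * (y ^ 2 * w ^ 7 - 1)) (m : ℕ) :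
    w = A ^ ((7 ^ m - 1) / 6) * y ^ (2 * ((7 ^ m - 1) / 6)) * w ^ 7 ^ m -
      ∑ i ∈ Finset.Icc 1 m, A ^ ((7 ^ i - 1) / 6) * y ^ (2 * ((7 ^ (i - 1) - 1) / 6)) := by
  have : Fact (Nat.Prime 7) := ⟨by norm_num⟩
  induction m with
  | zero => simp
  | succ m ih =>
    have hpow : w ^ 7 ^ m = A ^ 7 ^ m * (y ^ (2 * 7 ^ m) * w ^ 7 ^ (m + 1) - 1) := by
      conv_lhs => rw [h]
      rw [mul_pow, sub_pow_char_pow, one_pow, mul_pow, ← pow_mul, ← pow_mul, pow_succ' 7 m]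
    have hg : (7 ^ (m + 1) - 1) / 6 = (7 ^ m - 1) / 6 + 7 ^ m := by
      have := seven_pow_eq m
      rw [pow_succ]
      omega
    rw [Finset.sum_Icc_succ_top (by omega), Nat.add_sub_cancel, hg]
    rw [hpow] at ih
    conv_lhs => rw [ih]
    ring

theorem pow_half_eq_neg_one_iff_not_isSquare {F : Type*} [Field F] [Fintype F]
    (hF : ringChar F ≠ 2) {a : F} (ha : a ≠ 0) :
    a ^ (Fintype.card F / 2) = -1 ↔ ¬ IsSquare a := by
  rw [FiniteField.isSquare_iff hF ha]
  refine ⟨fun h h' => Ring.neg_one_ne_one_of_char_ne_two hF (h.symm.trans h'), fun h => ?_⟩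
  exact (FiniteField.pow_dichotomy hF ha).resolve_left h

/-- `f(x) = x^7 - 3a x^5 + 3a^2 x^3 - a^3 x` permutes `F = 𝔽_{7^n}` iff
`a^{(7^n-1)/2} = -1`, and in that case its explicit inverse is given. -/
theorem stmt_13 (n : ℕ) (hn : 0 < n)
    (F : Type*) [Field F] [Fintype F] (hF : Fintype.card F = 7 ^ n)
    (a : F) (ha : a ≠ 0)
    (f : F → F)
    (hf : ∀ c, f c = c ^ 7 - 3 * a * c ^ 5 + 3 * a ^ 2 * c ^ 3 - a ^ 3 * c)
    (b : ℕ → ℕ → ℕ → F)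
    (hb : ∀ i j k, b i j k =
      if i = j ∧ j = k then 1 else if i < j ∧ j < k then 6 else 3)
    (h₃ : F → F)
    (hh₃ : ∀ x, h₃ x = ∑ i ∈ Finset.Icc 1 n, ∑ j ∈ Finset.Icc i n,
      ∑ k ∈ Finset.Icc j n,
        (a⁻¹) ^ ((7 ^ i + 7 ^ j + 7 ^ k - 3) / 6) * b i j k *
          x ^ ((7 ^ (i - 1) + 7 ^ (j - 1) + 7 ^ (k - 1)) / 3)) :
    (Function.Bijective f ↔ a ^ ((7 ^ n - 1) / 2) = -1) ∧
      (a ^ ((7 ^ n - 1) / 2) = -1 → ∀ c : F,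
        (3 * (a * (f c) ^ 4) ^ ((7 ^ n - 1) / 6) -
            3 * (a * f c) ^ ((7 ^ n - 1) / 3) - 2) * h₃ (f c) = c) := by
  have : Fact (Nat.Prime 7) := ⟨by norm_num⟩
  have : CharP F 7 := charP_of_card_eq_prime_pow hF
  have h7 : (7 : F) = 0 := by exact_mod_cast CharP.cast_eq_zero F 7
  have hchar : ringChar F ≠ 2 := by
    rw [ringChar.eq F 7]
    norm_num
  obtain ⟨e, he⟩ : ∃ e, e = (7 ^ n - 1) / 6 := ⟨_, rfl⟩
  have hen : 7 ^ n = 6 * e + 1 := he ▸ seven_pow_eq n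
  have hhalf : (7 ^ n - 1) / 2 = 3 * e := by omega
  have hthird : (7 ^ n - 1) / 3 = 2 * e := by omega
  have hsq : a ^ (3 * e) = -1 ↔ ¬ IsSquare a := by
    rw [← pow_half_eq_neg_one_iff_not_isSquare hchar ha, hF]
    rw [show 7 ^ n / 2 = 3 * e by omega]
  have hfac (c : F) : f c = c * (c ^ 2 - a) ^ 3 := by
    rw [hf]
    ring
  have hh (x : F) : h₃ x = x * (∑ i ∈ Finset.Icc 1 n,
      a⁻¹ ^ ((7 ^ i - 1) / 6) * x ^ (2 * ((7 ^ (i - 1) - 1) / 6))) ^ 3 := by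
    rw [hh₃, sum_Icc_cube, Finset.mul_sum]
    refine Finset.sum_congr rfl fun i _ => ?_
    rw [Finset.mul_sum]
    refine Finset.sum_congr rfl fun j _ => ?_
    rw [Finset.mul_sum]
    refine Finset.sum_congr rfl fun k _ => ?_
    have hA : (7 ^ i + 7 ^ j + 7 ^ k - 3) / 6 =
        (7 ^ i - 1) / 6 + (7 ^ j - 1) / 6 + (7 ^ k - 1) / 6 := by
      have := seven_pow_eq i
      have := seven_pow_eq j
      have := seven_pow_eq k
      omega
    have hx : (7 ^ (i - 1) + 7 ^ (j - 1) + 7 ^ (k - 1)) / 3 = 2 * ((7 ^ (i - 1) - 1) / 6) +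
        2 * ((7 ^ (j - 1) - 1) / 6) + 2 * ((7 ^ (k - 1) - 1) / 6) + 1 := by
      have := seven_pow_eq (i - 1)
      have := seven_pow_eq (j - 1)
      have := seven_pow_eq (k - 1)
      omega
    rw [hb, hA, hx]
    simp only [pow_add, pow_one]
    ring
  rw [hhalf, hthird, ← he, hsq]
  have key (hns : ¬ IsSquare a) (c : F) :
      (3 * (a * (f c) ^ 4) ^ e - 3 * (a * f c) ^ (2 * e) - 2) * h₃ (f c) = c := by
    rcases eq_or_ne c 0 with rfl | hc
    · simp [hfac, hh]
    have hd : c ^ 2 - a ≠ 0 := fun h => hns ⟨c, by linear_combination -h⟩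
    have hy : f c ≠ 0 := by
      rw [hfac]
      exact mul_ne_zero hc (pow_ne_zero 3 hd)
    have hyc := hfac c
    rw [hh]
    generalize f c = y at hy hyc ⊢
    obtain ⟨w, hw⟩ : ∃ w, w = (c ^ 2 - a)⁻¹ := ⟨_, rfl⟩
    have hcw : c = y * w ^ 3 := by
      rw [hyc, hw]
      field_simp
    have hrec : w = a⁻¹ * (y ^ 2 * w ^ 7 - 1) := by
      rw [hyc, hw]
      field_simp
      ring
    have hiter := eq_iterate_of_eq_mul_pow_seven hrec n
    rw [← hF, FiniteField.pow_card, hF, ← he] at hiter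
    generalize ∑ i ∈ Finset.Icc 1 n,
      a⁻¹ ^ ((7 ^ i - 1) / 6) * y ^ (2 * ((7 ^ (i - 1) - 1) / 6)) = S at hiter ⊢
    have ha3 : (a ^ e) ^ 3 = -1 := by
      rw [← pow_mul, mul_comm, hsq]
      exact hns
    have hy6 : (y ^ e) ^ 6 = 1 := by
      rw [← pow_mul, ← FiniteField.pow_card_sub_one_eq_one y hy, hF]
      congr 1
      omega
    have hinv : a⁻¹ ^ e = -(a ^ e) ^ 2 := by
      rw [inv_pow]
      refine inv_eq_of_mul_eq_one_right ?_
      linear_combination -ha3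
    rw [hinv, mul_comm 2 e, pow_mul] at hiter
    have hfactor : 3 * (a * y ^ 4) ^ e - 3 * (a * y) ^ (2 * e) - 2 =
        3 * a ^ e * (y ^ e) ^ 4 - 3 * (a ^ e) ^ 2 * (y ^ e) ^ 2 - 2 := by
      ring
    rw [hfactor]
    generalize a ^ e = p at ha3 hiter ⊢
    generalize y ^ e = z at hy6 hiter ⊢
    have hS : S = -(w * (1 + p ^ 2 * z ^ 2)) := by linear_combination hiter
    obtain ⟨t, ht⟩ : ∃ t, t = -(p ^ 2 * z ^ 2) := ⟨_, rfl⟩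
    have ht3 : t ^ 3 = -1 := by
      rw [ht]
      linear_combination (-z ^ 6 * (p ^ 3 - 1)) * ha3 - hy6
    have ht2 : p * z ^ 4 = -t ^ 2 := by
      rw [ht]
      linear_combination p * z ^ 4 * ha3
    have hS' : S = -(w * (1 - t)) := by
      rw [hS, ht]
      ring
    have hval : 3 * p * z ^ 4 - 3 * p ^ 2 * z ^ 2 - 2 = -(1 - t) ^ 3 := by
      linear_combination 3 * ht2 - 3 * ht - ht3
    have hone : (1 - t) ^ 6 = 1 := by
      linear_combination (t ^ 3 - 6 * t ^ 2 + 15 * t - 21) * ht3 + (3 * t ^ 2 - 3 * t + 3) * h7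
    rw [hval, hS', hcw]
    linear_combination (y * w ^ 3) * hone
  refine ⟨⟨?_, fun hns => ?_⟩, key⟩
  · rintro hbij ⟨s, rfl⟩
    have hs : s = 0 := hbij.injective (by simp [hfac, sq])
    exact ha (by simp [hs])
  · refine Finite.injective_iff_bijective.mp fun c d hcd => ?_
    rw [← key hns c, ← key hns d, hcd]
end
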